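/- arXiv:2303.00209 — 2 statements merged into one kernel-verified Lean document; each statement's English description precedes it below -/
import Mathlib

section
/- There exist absolute constants C > 0 and N₀ ∈ ℕ such that the following holds. Let 𝒳, 𝒜 be finite sets with n = log₂|𝒳|, and let M : 𝒜 × 𝒳 → {−1,1} be a (k',ℓ')-L2 extractor with error 2^{−r'}, where k', ℓ', r' ≥ N₀ and ℓ' ≤ n. Set r = min{r'/4, ℓ'/26 + 1/6, (k'−1)/2}. Let ρ be a branching program with hybrid memory for the learning problem corresponding to M, with q-qubit quantum memory, m-bit classical memory and length T. If m ≤ (k'−1)ℓ'/44, q ≤ r − 7 and T ≤ 2^{r−2}, then the success probability of ρ is at most C·2^{q−r}. -/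
open scoped ComplexOrder Classical
open Matrix

noncomputable section

/-- `log₂` of the cardinality of a finite set. -/
def nbits (X : Type*) [Fintype X] : ℝ := Real.logb 2 (Fintype.card X)

/-- `M` is a `(k, l)`-L2 extractor with error `e`: for every probability distribution `P` on `X`
with `‖P‖₂ ≤ 2^l · 2^{−n/2}`, at most a `2^{−k}` fraction of the rows `a` satisfy
`|⟨M_a, P⟩| ≥ e`. -/
def IsL2Extractor {A X : Type*} [Fintype A] [Fintype X]
    (M : A → X → ℝ) (k l e : ℝ) : Prop :=
  ∀ P : X → ℝ, (∀ x, 0 ≤ P x) → (∑ x, P x) = 1 →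
    Real.sqrt (∑ x, P x ^ 2) ≤ 2 ^ l * 2 ^ (-(nbits X) / 2) →
    (({a : A | e ≤ |∑ x, M a x * P x|} : Set A).ncard : ℝ) ≤
      2 ^ (-k) * (Fintype.card A : ℝ)

/-- The extension `f ⊗ id` of a linear map on matrices over `n` to matrices over `n × m`
(an ancilla system `m`). -/
def matExt {n m : Type*} (f : Matrix n n ℂ →ₗ[ℂ] Matrix n n ℂ)
    (A : Matrix (n × m) (n × m) ℂ) : Matrix (n × m) (n × m) ℂ :=
  Matrix.of fun p q => f (Matrix.of fun i j => A (i, p.2) (j, q.2)) p.1 q.1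

/-- A quantum channel on the finite-dimensional Hilbert space `ℂ^n`: a completely positive
trace-preserving linear map on complex matrices over `n`. -/
structure QChannel (n : Type*) [Fintype n] [DecidableEq n] where
  map : Matrix n n ℂ →ₗ[ℂ] Matrix n n ℂ
  trace_preserving : ∀ A : Matrix n n ℂ, (map A).trace = A.trace
  completely_positive : ∀ (k : ℕ) (A : Matrix (n × Fin k) (n × Fin k) ℂ),
    A.PosSemidef → (matExt map A).PosSemidef

/-- A matrix on `𝒱 ⊗ ℂ^𝒲` is classical on `W`. -/
def ClassicalOnW {V W : Type*} (σ : Matrix (V × W) (V × W) ℂ) : Prop :=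
  ∀ p q : V × W, p.2 ≠ q.2 → σ p q = 0

/-- The evolution of the joint state `ρ^{(t)}_{XVW}` of a branching program with hybrid memory
(`q` qubits of quantum memory `V` and `m` bits of classical memory `W`) for the learning
problem corresponding to `M`:
`ρ^{(0)}_{XVW} = 2^{−n}·I_X ⊗ 2^{−q}·I_V ⊗ 2^{−m}·I_W` and
`ρ^{(t+1)}_{XVW} = (1/|𝒜|) Σ_{a,x} |x⟩⟨x| ⊗ Φ_{t,a,M(a,x)}(ρ^{(t)}_{VW|x})`. -/
def rhoSeq {X A : Type*} [Fintype X] [DecidableEq X] [Fintype A] {q m : ℕ}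
    (M : A → X → ℝ)
    (Φ : ℕ → A → ℝ → QChannel (Fin (2 ^ q) × (Fin m → Bool))) :
    ℕ → Matrix (X × (Fin (2 ^ q) × (Fin m → Bool))) (X × (Fin (2 ^ q) × (Fin m → Bool))) ℂ
  | 0 => ((Fintype.card X : ℂ) * 2 ^ q * 2 ^ m)⁻¹ • 1
  | (t + 1) => (Fintype.card A : ℂ)⁻¹ • ∑ a : A, ∑ x : X,
      (Matrix.of fun p p' : X × (Fin (2 ^ q) × (Fin m → Bool)) =>
        if p.1 = x ∧ p'.1 = x then
          (Φ t a (M a x)).map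
            (Matrix.of fun u u' => rhoSeq M Φ t (x, u) (x, u')) p.2 p'.2
        else 0)

/-- The success probability of a branching program of length `T` with output function `out`:
the probability that measuring the memory in the computational basis at stage `T` yields
`(v,w)` with `out (v,w) = x`. -/
def succProb {X A : Type*} [Fintype X] [DecidableEq X] [Fintype A] {q m : ℕ}
    (M : A → X → ℝ)
    (Φ : ℕ → A → ℝ → QChannel (Fin (2 ^ q) × (Fin m → Bool)))
    (out : Fin (2 ^ q) × (Fin m → Bool) → X) (T : ℕ) : ℝ :=
  ∑ v : Fin (2 ^ q), ∑ w : Fin m → Bool,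
    (rhoSeq M Φ T (out (v, w), (v, w)) (out (v, w), (v, w))).re

section HybridMemory

open scoped MatrixOrder

variable {V : Type} [Fintype V]

/-- Real part of the trace, as a real-linear functional. -/
def reTrace : Matrix V V ℂ →ₗ[ℝ] ℝ where
  toFun Y := Y.trace.re
  map_add' := by simp
  map_smul' := by simp

/-- The quadratic form `Y ↦ ⟨v|Y|v⟩`, as a real-linear functional of `Y`. -/
def qform (v : V → ℂ) : Matrix V V ℂ →ₗ[ℝ] ℝ where
  toFun Y := (star v ⬝ᵥ (Y *ᵥ v)).re
  map_add' := by simp [Matrix.add_mulVec]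
  map_smul' := by simp [Matrix.smul_mulVec]

/-- The congruence `Y ↦ P Y Pᴴ`, as a real-linear map. -/
def sandwich (P : Matrix V V ℂ) : Matrix V V ℂ →ₗ[ℝ] Matrix V V ℂ where
  toFun Y := P * Y * Pᴴ
  map_add' := by simp [mul_add, add_mul]
  map_smul' := by simp

lemma reTrace_apply (Y : Matrix V V ℂ) : reTrace Y = Y.trace.re := rfl

lemma qform_apply (v : V → ℂ) (Y : Matrix V V ℂ) : qform v Y = (star v ⬝ᵥ (Y *ᵥ v)).re := rfl

lemma sandwich_apply (P Y : Matrix V V ℂ) : sandwich P Y = P * Y * Pᴴ := rfl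

lemma reTrace_nonneg {Y : Matrix V V ℂ} (hY : 0 ≤ Y) : 0 ≤ reTrace Y :=
  (Complex.le_def.1 (nonneg_iff_posSemidef.1 hY).trace_nonneg).1

lemma qform_nonneg (v : V → ℂ) {Y : Matrix V V ℂ} (hY : 0 ≤ Y) : 0 ≤ qform v Y :=
  (Complex.le_def.1 ((nonneg_iff_posSemidef.1 hY).dotProduct_mulVec_nonneg v)).1

lemma sandwich_nonneg (P : Matrix V V ℂ) {Y : Matrix V V ℂ} (hY : 0 ≤ Y) : 0 ≤ sandwich P Y :=
  nonneg_iff_posSemidef.2 ((nonneg_iff_posSemidef.1 hY).mul_mul_conjTranspose_same P)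

/-- A positive real-linear map is monotone. -/
lemma map_le_of_nonneg {E F : Type*} [AddCommGroup E] [Module ℝ E] [PartialOrder E]
    [IsOrderedAddMonoid E] [AddCommGroup F] [Module ℝ F] [PartialOrder F] [IsOrderedAddMonoid F]
    (e : E →ₗ[ℝ] F) (he : ∀ Y, 0 ≤ Y → 0 ≤ e Y) {A B : E} (h : A ≤ B) : e A ≤ e B := by
  have := he (B - A) (sub_nonneg.2 h)
  rwa [map_sub, sub_nonneg] at this

lemma smul_nonneg_matrix {c : ℝ} (hc : 0 ≤ c) {Y : Matrix V V ℂ} (hY : 0 ≤ Y) : 0 ≤ c • Y :=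
  nonneg_iff_posSemidef.2 ((nonneg_iff_posSemidef.1 hY).smul hc)

lemma smul_le_smul_matrix {c : ℝ} (hc : 0 ≤ c) {A B : Matrix V V ℂ} (h : A ≤ B) :
    c • A ≤ c • B := by
  have := smul_nonneg_matrix hc (sub_nonneg.2 h)
  rwa [smul_sub, sub_nonneg] at this

lemma smul_le_smul_right_matrix {c d : ℝ} (h : c ≤ d) {A : Matrix V V ℂ} (hA : 0 ≤ A) :
    c • A ≤ d • A := by
  have := smul_nonneg_matrix (sub_nonneg.2 h) hA
  rwa [sub_smul, sub_nonneg] at this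

lemma isHermitian_of_nonneg {Y : Matrix V V ℂ} (hY : 0 ≤ Y) : Y.IsHermitian :=
  (nonneg_iff_posSemidef.1 hY).isHermitian

lemma qform_eq (v : V → ℂ) {Y : Matrix V V ℂ} (hY : Y.IsHermitian) :
    star v ⬝ᵥ (Y *ᵥ v) = (qform v Y : ℂ) := by
  apply Complex.ext
  · simp [qform_apply]
  · simpa using hY.im_star_dotProduct_mulVec_self v

lemma nonneg_of_qform {Y : Matrix V V ℂ} (hY : Y.IsHermitian) (h : ∀ v, 0 ≤ qform v Y) :
    0 ≤ Y := by
  refine nonneg_iff_posSemidef.2 (PosSemidef.of_dotProduct_mulVec_nonneg hY fun v => ?_)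
  rw [qform_eq v hY]
  exact_mod_cast h v

lemma le_of_qform {A B : Matrix V V ℂ} (hA : A.IsHermitian) (hB : B.IsHermitian)
    (h : ∀ v, qform v A ≤ qform v B) : A ≤ B := by
  refine sub_nonneg.1 (nonneg_of_qform (hB.sub hA) fun v => ?_)
  rw [map_sub]
  exact sub_nonneg.2 (h v)

lemma qform_mono (v : V → ℂ) {A B : Matrix V V ℂ} (h : A ≤ B) : qform v A ≤ qform v B :=
  map_le_of_nonneg _ (fun _ => qform_nonneg v) h

lemma reTrace_mono {A B : Matrix V V ℂ} (h : A ≤ B) : reTrace A ≤ reTrace B :=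
  map_le_of_nonneg _ (fun _ => reTrace_nonneg) h

lemma qform_sandwich (P Y : Matrix V V ℂ) (v : V → ℂ) :
    qform v (sandwich P Y) = qform (Pᴴ *ᵥ v) Y := by
  simp only [qform_apply, sandwich_apply, star_mulVec, conjTranspose_conjTranspose,
    ← mulVec_mulVec, dotProduct_mulVec, vecMul_vecMul]

lemma reTrace_sandwich_le (P : Matrix V V ℂ) (hP : P.IsHermitian) (hPP : P * P = P)
    {Y : Matrix V V ℂ} (hY : 0 ≤ Y) : reTrace (sandwich P Y) ≤ reTrace Y := by
  have h1 : reTrace (sandwich P Y) = (P * Y).trace.re := by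
    rw [reTrace_apply, sandwich_apply, hP.eq, Matrix.trace_mul_comm, ← mul_assoc, hPP]
  have h2 := reTrace_nonneg (sandwich_nonneg (1 - P) hY)
  have h3 : reTrace (sandwich (1 - P) Y) = reTrace Y - (P * Y).trace.re := by
    rw [reTrace_apply, sandwich_apply, conjTranspose_sub, hP.eq, conjTranspose_one,
      Matrix.trace_mul_comm, ← mul_assoc]
    have : (1 - P) * (1 - P) = 1 - P := by
      rw [sub_mul, mul_sub, mul_sub, hPP]; simp
    rw [this, sub_mul, Matrix.trace_sub, one_mul, Complex.sub_re, reTrace_apply]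
  linarith

/-- A finite family of positive functionals which together are dominated by the trace: the outcome
probabilities of a (sub-normalised) measurement. -/
structure IsSubMeasurement {ι : Type} [Fintype ι] (e : ι → Matrix V V ℂ →ₗ[ℝ] ℝ) : Prop where
  nonneg : ∀ i Y, 0 ≤ Y → 0 ≤ e i Y
  sum_le : ∀ Y, 0 ≤ Y → ∑ i, e i Y ≤ reTrace Y

/-- The number `B` bounds the measured Rényi quantity `∑ i, (e i σ)^(k+1) / (e i τ)^k` over all
sub-normalised measurements `e`; the quotient is written in its variational form. -/
def RenyiBound (k : ℕ) (σ τ : Matrix V V ℂ) (B : ℝ) : Prop :=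
  ∀ (ι : Type) [Fintype ι] (e : ι → Matrix V V ℂ →ₗ[ℝ] ℝ) (c : ι → ℝ),
    IsSubMeasurement e → (∀ i, 0 ≤ c i) →
      ∑ i, ((k + 1) * c i ^ k * e i σ - k * c i ^ (k + 1) * e i τ) ≤ B

lemma RenyiBound.nonneg {k : ℕ} {σ τ : Matrix V V ℂ} {B : ℝ} (h : RenyiBound k σ τ B) :
    0 ≤ B := by
  have := h Empty (fun i => i.elim) (fun i => i.elim)
    ⟨fun i => i.elim, fun Y hY => by simpa using reTrace_nonneg hY⟩ (fun i => i.elim)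
  simpa using this

lemma RenyiBound.mono {k : ℕ} {σ τ σ' τ' : Matrix V V ℂ} {B α β : ℝ}
    (h : RenyiBound k σ τ B) (hα : 0 < α) (hβ : 0 < β) (hσ : σ' ≤ α • σ) (hτ : β • τ ≤ τ') :
    RenyiBound k σ' τ' (α ^ (k + 1) / β ^ k * B) := by
  intro ι _ e c he hc
  have key := h ι e (fun i => c i * β / α) he (fun i => by have := hc i; positivity)
  refine le_trans ?_ (mul_le_mul_of_nonneg_left key (by positivity))
  rw [Finset.mul_sum]
  refine Finset.sum_le_sum fun i _ => ?_
  have h1 : e i σ' ≤ α * e i σ := by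
    have := map_le_of_nonneg (e i) (he.nonneg i) hσ
    simpa using this
  have h2 : β * e i τ ≤ e i τ' := by
    have := map_le_of_nonneg (e i) (he.nonneg i) hτ
    simpa using this
  have hci := hc i
  have e1 : α ^ (k + 1) / β ^ k * ((k + 1) * (c i * β / α) ^ k * e i σ
      - k * (c i * β / α) ^ (k + 1) * e i τ)
      = (k + 1) * c i ^ k * (α * e i σ) - k * c i ^ (k + 1) * (β * e i τ) := by
    rw [div_pow, div_pow, mul_pow, mul_pow]
    field_simp
    ring
  rw [e1]
  have h3 := mul_le_mul_of_nonneg_left h1 (show 0 ≤ ((k : ℝ) + 1) * c i ^ k by positivity)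
  have h4 := mul_le_mul_of_nonneg_left h2 (show 0 ≤ (k : ℝ) * c i ^ (k + 1) by positivity)
  linarith

lemma RenyiBound.sandwich {k : ℕ} {σ τ : Matrix V V ℂ} {B : ℝ} (h : RenyiBound k σ τ B)
    {P : Matrix V V ℂ} (hP : P.IsHermitian) (hPP : P * P = P) :
    RenyiBound k (sandwich P σ) (sandwich P τ) B := by
  intro ι _ e c he hc
  exact h ι (fun i => (e i).comp (_root_.sandwich P)) c
    ⟨fun i Y hY => he.nonneg i _ (sandwich_nonneg P hY),
      fun Y hY => (he.sum_le _ (sandwich_nonneg P hY)).trans (reTrace_sandwich_le P hP hPP hY)⟩ hc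

lemma weighted_amgm (k : ℕ) {s c : ℝ} (hs : 0 ≤ s) (hc : 0 ≤ c) :
    (k + 1) * c ^ k * s - k * c ^ (k + 1) ≤ s ^ (k + 1) := by
  rcases hc.eq_or_lt with rfl | hc
  · rcases k with _ | k
    · simp
    · simp; positivity
  have h := one_add_mul_le_pow (a := s / c - 1) (by have := div_nonneg hs hc.le; linarith) (k + 1)
  have h2 := mul_le_mul_of_nonneg_left h (pow_pos hc (k + 1)).le
  have e1 : c ^ (k + 1) * (1 + (s / c - 1)) ^ (k + 1) = s ^ (k + 1) := by
    rw [← mul_pow]; congr 1; field_simp; ring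
  have e2 : c ^ (k + 1) * (1 + ((k + 1 : ℕ) : ℝ) * (s / c - 1))
      = (k + 1) * c ^ k * s - k * c ^ (k + 1) := by
    push_cast; field_simp; ring
  rw [e1, e2] at h2
  exact h2

lemma RenyiBound.of_smul {k : ℕ} {τ : Matrix V V ℂ} {s : ℝ} (hs : 0 ≤ s) (hτ : 0 ≤ τ) :
    RenyiBound k (s • τ) τ (s ^ (k + 1) * reTrace τ) := by
  intro ι _ e c he hc
  have h1 : ∑ i, ((k + 1) * c i ^ k * e i (s • τ) - k * c i ^ (k + 1) * e i τ)
      ≤ ∑ i, s ^ (k + 1) * e i τ := by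
    refine Finset.sum_le_sum fun i _ => ?_
    have := mul_le_mul_of_nonneg_right (weighted_amgm k hs (hc i)) (he.nonneg i τ hτ)
    simp only [map_smul, smul_eq_mul]
    linarith
  rw [← Finset.mul_sum] at h1
  exact h1.trans (mul_le_mul_of_nonneg_left (he.sum_le τ hτ) (by positivity))

lemma qform_le_reTrace {v : V → ℂ} (hv : star v ⬝ᵥ v = 1) {Y : Matrix V V ℂ} (hY : 0 ≤ Y) :
    qform v Y ≤ reTrace Y := by
  have hP : (vecMulVec v (star v)).IsHermitian := by
    rw [IsHermitian, conjTranspose_vecMulVec, star_star]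
  have hPP : vecMulVec v (star v) * vecMulVec v (star v) = vecMulVec v (star v) := by
    rw [vecMulVec_mul_vecMulVec, hv]; simp
  have h := reTrace_sandwich_le _ hP hPP hY
  refine le_trans (le_of_eq ?_) h
  rw [reTrace_apply, sandwich_apply, hP.eq, Matrix.trace_mul_comm, ← mul_assoc, hPP,
    vecMulVec_mul, trace_vecMulVec, dotProduct_comm, ← dotProduct_mulVec, qform_apply]

/-- The bound controls the weight of any direction in which `σ` is at least `L τ`. -/
lemma RenyiBound.qform_le {k : ℕ} {σ τ : Matrix V V ℂ} {B L : ℝ} (h : RenyiBound k σ τ B)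
    {v : V → ℂ} (hv : star v ⬝ᵥ v = 1) (hL : 0 < L) (hσ : L * qform v τ ≤ qform v σ) :
    qform v τ ≤ B / L ^ (k + 1) := by
  have key := h Unit (fun _ => qform v) (fun _ => L)
    ⟨fun _ _ => qform_nonneg v, fun Y hY => by simpa using qform_le_reTrace hv hY⟩
    (fun _ => hL.le)
  simp only [Finset.univ_unique, Finset.sum_singleton] at key
  rw [le_div_iff₀ (by positivity)]
  have := mul_le_mul_of_nonneg_left hσ (show 0 ≤ ((k : ℝ) + 1) * L ^ k by positivity)
  have e : ((k : ℝ) + 1) * L ^ k * (L * qform v τ) - k * L ^ (k + 1) * qform v τ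
    = qform v τ * L ^ (k + 1) := by ring
  linarith

/-- Every unit-`ℓ₂`-norm weighting `g ≥ 0` satisfies `∑ g x • ξ x ≤ L • ∑ ξ x`. For a family of
sub-normalised conditional states this says that the distribution on `X` conditioned on any
measurement outcome has `ℓ₂`-norm at most `L`. -/
def L2Bound {X : Type} [Fintype X] (L : ℝ) (ξ : X → Matrix V V ℂ) : Prop :=
  ∀ g : X → ℝ, (∀ x, 0 ≤ g x) → ∑ x, g x ^ 2 ≤ 1 → ∑ x, g x • ξ x ≤ L • ∑ x, ξ x

lemma sandwich_add_le (A B : Matrix V V ℂ) {η : ℝ} (hη : 0 < η) {Y : Matrix V V ℂ}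
    (hY : 0 ≤ Y) :
    sandwich (A + B) Y ≤ (1 + η) • sandwich A Y + (1 + 1 / η) • sandwich B Y := by
  have h := sandwich_nonneg ((Real.sqrt η) • A - (Real.sqrt η)⁻¹ • B) hY
  rw [← sub_nonneg]
  convert h using 1
  have h1 : Real.sqrt η * Real.sqrt η = η := Real.mul_self_sqrt hη.le
  have h0 : Real.sqrt η ≠ 0 := (Real.sqrt_pos.2 hη).ne'
  have h2 : (Real.sqrt η)⁻¹ * (Real.sqrt η)⁻¹ = 1 / η := by rw [← mul_inv, h1, one_div]
  simp only [sandwich_apply, conjTranspose_add, conjTranspose_sub, conjTranspose_smul, star_trivial,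
    add_mul, mul_add, sub_mul, mul_sub, Matrix.smul_mul, Matrix.mul_smul, smul_smul, h1, h2,
    add_smul, one_smul, mul_inv_cancel₀ h0, inv_mul_cancel₀ h0]
  abel

lemma isHermitian_rankOne (v : V → ℂ) : (vecMulVec v (star v)).IsHermitian := by
  rw [IsHermitian, conjTranspose_vecMulVec, star_star]

lemma rankOne_mul_self {v : V → ℂ} (hv : star v ⬝ᵥ v = 1) :
    vecMulVec v (star v) * vecMulVec v (star v) = vecMulVec v (star v) := by
  rw [vecMulVec_mul_vecMulVec, hv]; simp

lemma reTrace_sandwich_rankOne {v : V → ℂ} (hv : star v ⬝ᵥ v = 1) (Y : Matrix V V ℂ) :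
    reTrace (sandwich (vecMulVec v (star v)) Y) = qform v Y := by
  rw [reTrace_apply, sandwich_apply, (isHermitian_rankOne v).eq, Matrix.trace_mul_comm,
    ← mul_assoc, rankOne_mul_self hv,
    vecMulVec_mul, trace_vecMulVec, dotProduct_comm, ← dotProduct_mulVec, qform_apply]

lemma qform_smul (c : ℝ) (v : V → ℂ) (Y : Matrix V V ℂ) :
    qform (c • v) Y = c ^ 2 * qform v Y := by
  simp only [qform_apply, star_smul, mulVec_smul, smul_dotProduct, dotProduct_smul, star_trivial,
    Complex.smul_re, smul_eq_mul]
  ring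

lemma exists_normalize {v : V → ℂ} (hv : v ≠ 0) :
    ∃ c : ℝ, 0 < c ∧ star (c • v) ⬝ᵥ (c • v) = 1 := by
  have h0 : 0 < star v ⬝ᵥ v := dotProduct_star_self_pos_iff.2 hv
  obtain ⟨s, hs⟩ : ∃ s : ℝ, star v ⬝ᵥ v = s := by
    refine ⟨(star v ⬝ᵥ v).re, ?_⟩
    apply Complex.ext
    · simp
    · simpa using (Complex.le_def.1 h0.le).2.symm
  rw [hs] at h0
  have hs0 : 0 < s := by exact_mod_cast h0
  refine ⟨(Real.sqrt s)⁻¹, by positivity, ?_⟩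
  simp only [star_smul, smul_dotProduct, dotProduct_smul, star_trivial, hs, smul_smul,
    ← mul_inv, Real.mul_self_sqrt hs0.le]
  simp [hs0.ne']

/-- One can project away, one at a time, all directions in which the conditional distribution has
large `ℓ₂`-norm, at a small cost if each such direction carries small weight `δ`. -/
lemma exists_projection_aux {X : Type} [Fintype X] {π : X → Matrix V V ℂ} (hπ : ∀ x, 0 ≤ π x)
    {L δ η : ℝ} (hη : 0 < η) (hδ : 0 ≤ δ)
    (H : ∀ v : V → ℂ, star v ⬝ᵥ v = 1 → ∀ g : X → ℝ, (∀ x, 0 ≤ g x) → ∑ x, g x ^ 2 ≤ 1 →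
      L * qform v (∑ x, π x) < qform v (∑ x, g x • π x) → qform v (∑ x, π x) ≤ δ) (N : ℕ) :
    ∀ P : Matrix V V ℂ, P.IsHermitian → P * P = P → reTrace P ≤ N →
      ∃ P' : Matrix V V ℂ, P'.IsHermitian ∧ P' * P' = P' ∧
        L2Bound L (fun x => sandwich P' (π x)) ∧
        ∃ E : X → Matrix V V ℂ, (∀ x, 0 ≤ E x) ∧
          ∑ x, reTrace (E x) ≤ N * (1 + η) ^ N * (1 + 1 / η) * δ ∧
          ∀ x, sandwich P (π x) ≤ (1 + η) ^ N • sandwich P' (π x) + E x := by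
  induction N with
  | zero =>
    intro P hP hPP htr
    have h0 : P = 0 := by
      have : (Pᴴ * P).trace = 0 := by
        have h1 : 0 ≤ Pᴴ * P := nonneg_iff_posSemidef.2 (posSemidef_conjTranspose_mul_self P)
        have h2 := (nonneg_iff_posSemidef.1 h1).trace_nonneg
        have h3 := Complex.le_def.1 h2
        rw [hP.eq, hPP] at h3 ⊢
        apply Complex.ext
        · exact le_antisymm (by simpa [reTrace_apply] using htr) h3.1
        · exact h3.2.symm
      exact trace_conjTranspose_mul_self_eq_zero_iff.1 this
    subst h0
    refine ⟨0, isHermitian_zero, by simp, ?_, 0, fun _ => le_rfl, by simp, fun x => by simp⟩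
    intro g _ _
    simp [sandwich_apply]
  | succ N ih =>
    intro P hP hPP htr
    by_cases hL : L2Bound L (fun x => sandwich P (π x))
    · refine ⟨P, hP, hPP, hL, 0, fun _ => le_rfl, ?_, fun x => ?_⟩
      · simp; positivity
      · have h1 : (1 : ℝ) ≤ (1 + η) ^ (N + 1) := one_le_pow₀ (by linarith)
        have := smul_le_smul_right_matrix h1 (sandwich_nonneg P (hπ x))
        simpa using this
    unfold L2Bound at hL
    push Not at hL
    obtain ⟨g, hg0, hg1, hg⟩ := hL
    have hsum : ∑ x, g x • sandwich P (π x) = sandwich P (∑ x, g x • π x) := by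
      simp [map_sum]
    have hsum' : ∑ x, sandwich P (π x) = sandwich P (∑ x, π x) := by simp [map_sum]
    have hpos : 0 ≤ ∑ x, π x := Finset.sum_nonneg fun x _ => hπ x
    have hgpos : 0 ≤ ∑ x, g x • π x :=
      Finset.sum_nonneg fun x _ => smul_nonneg_matrix (hg0 x) (hπ x)
    obtain ⟨v₀, hv₀⟩ : ∃ v, qform v (L • sandwich P (∑ x, π x))
        < qform v (sandwich P (∑ x, g x • π x)) := by
      by_contra hcon
      push Not at hcon
      apply hg
      rw [hsum, hsum']
      refine le_of_qform (isHermitian_of_nonneg (sandwich_nonneg P hgpos)) ?_ hcon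
      have := isHermitian_of_nonneg (sandwich_nonneg P hpos)
      rw [IsHermitian, conjTranspose_smul, this.eq, star_trivial]
    rw [map_smul, qform_sandwich, qform_sandwich, hP.eq, smul_eq_mul] at hv₀
    set u := P *ᵥ v₀ with hu
    have hu0 : u ≠ 0 := by
      intro h
      rw [h] at hv₀
      simp [qform_apply] at hv₀
    obtain ⟨c, hc, hv⟩ := exists_normalize hu0
    set v := c • u with hvdef
    have hPv : P *ᵥ v = v := by
      rw [hvdef, mulVec_smul, hu, mulVec_mulVec, hPP]
    have hvP : star v ᵥ* P = star v := by
      have := congrArg star hPv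
      rwa [star_mulVec, hP.eq] at this
    have hδv : qform v (∑ x, π x) ≤ δ := by
      refine H v hv g hg0 hg1 ?_
      rw [hvdef, qform_smul, qform_smul]
      have := mul_lt_mul_of_pos_left hv₀ (pow_pos hc 2)
      linarith
    set F := vecMulVec v (star v) with hF
    have hFH : F.IsHermitian := isHermitian_rankOne v
    have hFF : F * F = F := rankOne_mul_self hv
    have hPF : P * F = F := by rw [hF, mul_vecMulVec, hPv]
    have hFP : F * P = F := by rw [hF, vecMulVec_mul, hvP]
    obtain ⟨P', hP', hPP', hL', E, hE0, hEt, hE⟩ := ih (P - F) (hP.sub hFH)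
      (by rw [sub_mul, mul_sub, mul_sub, hPP, hFF, hPF, hFP]; simp)
      (by
        have : reTrace F = 1 := by
          rw [reTrace_apply, hF, trace_vecMulVec, dotProduct_comm, hv]; simp
        rw [map_sub, this]
        push_cast at htr
        linarith)
    refine ⟨P', hP', hPP', hL', fun x => (1 + η) • E x + (1 + 1 / η) • sandwich F (π x),
      fun x => ?_, ?_, fun x => ?_⟩
    · exact add_nonneg (smul_nonneg_matrix (by positivity) (hE0 x))
        (smul_nonneg_matrix (by positivity) (sandwich_nonneg F (hπ x)))
    · simp only [map_add, map_smul, smul_eq_mul, Finset.sum_add_distrib, ← Finset.mul_sum]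
      have h1 : ∑ x, reTrace (sandwich F (π x)) ≤ δ := by
        simp only [hF, reTrace_sandwich_rankOne hv]
        rwa [← map_sum]
      have h2 := mul_le_mul_of_nonneg_left hEt (show 0 ≤ 1 + η by positivity)
      have h3 := mul_le_mul_of_nonneg_left h1 (show 0 ≤ 1 + 1 / η by positivity)
      have h4 : (1 : ℝ) ≤ (1 + η) ^ (N + 1) := one_le_pow₀ (by linarith)
      have h5 := mul_le_mul_of_nonneg_right h4 (show 0 ≤ (1 + 1 / η) * δ by positivity)
      push_cast
      have e : ((N : ℝ) + 1) * (1 + η) ^ (N + 1) * (1 + 1 / η) * δ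
        = (1 + η) * (N * (1 + η) ^ N * (1 + 1 / η) * δ) + (1 + η) ^ (N + 1) * ((1 + 1 / η) * δ) := by
        ring
      linarith
    · have h1 := sandwich_add_le (P - F) F hη (hπ x)
      rw [sub_add_cancel] at h1
      have h2 := smul_le_smul_matrix (show 0 ≤ 1 + η by positivity) (hE x)
      refine h1.trans ((add_le_add_left h2 _).trans (le_of_eq ?_))
      rw [smul_add, smul_smul, pow_succ' (1 + η) N]
      exact add_assoc _ _ _

/-- A positive semidefinite matrix can be whitened. -/
lemma exists_whitening [DecidableEq V] {ξ : Matrix V V ℂ} (hξ : 0 ≤ ξ) :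
    ∃ Q C : Matrix V V ℂ, Cᴴ * C = ξ ∧ Qᴴ * ξ * Q ≤ 1 ∧
      ∀ Y, 0 ≤ Y → Y ≤ ξ → Cᴴ * (Qᴴ * Y * Q) * C = Y := by
  have hH := isHermitian_of_nonneg hξ
  have hps := nonneg_iff_posSemidef.1 hξ
  set U : Matrix V V ℂ := (hH.eigenvectorUnitary : Matrix V V ℂ) with hU
  have hUU : Uᴴ * U = 1 := by
    have := (Matrix.mem_unitaryGroup_iff').1 hH.eigenvectorUnitary.2
    simpa [star_eq_conjTranspose] using this
  have hUU' : U * Uᴴ = 1 := by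
    have := (Matrix.mem_unitaryGroup_iff).1 hH.eigenvectorUnitary.2
    simpa [star_eq_conjTranspose] using this
  set p : V → ℝ := hH.eigenvalues with hp
  have hp0 : ∀ i, 0 ≤ p i := hps.eigenvalues_nonneg
  have hspec : ξ = U * diagonal (fun i => (p i : ℂ)) * Uᴴ := by
    have := hH.spectral_theorem
    rw [Unitary.conjStarAlgAut_apply] at this
    exact this
  set s : V → ℂ := fun i => (Real.sqrt (p i) : ℂ) with hs
  have hss : ∀ i, s i * s i = p i := fun i => by
    simp only [hs]; rw [← Complex.ofReal_mul, Real.mul_self_sqrt (hp0 i)]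
  have hsstar : star s = s := by
    ext i; simp [hs]
  have hsinv : star s⁻¹ = s⁻¹ := by
    ext i; simp [hs]
  refine ⟨U * diagonal s⁻¹, diagonal s * Uᴴ, ?_, ?_, ?_⟩
  · rw [conjTranspose_mul, conjTranspose_conjTranspose, diagonal_conjTranspose, hsstar, hspec]
    rw [mul_assoc U, ← mul_assoc (diagonal s), diagonal_mul_diagonal, mul_assoc]
    simp only [hss]
  · have e : (U * diagonal s⁻¹)ᴴ * ξ * (U * diagonal s⁻¹)
        = diagonal (fun i => s⁻¹ i * p i * s⁻¹ i) := by
      rw [conjTranspose_mul, diagonal_conjTranspose, hsinv, hspec]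
      calc _ = diagonal s⁻¹ * (Uᴴ * U) * diagonal (fun i => (p i : ℂ)) * (Uᴴ * U)
            * diagonal s⁻¹ := by simp only [mul_assoc]
        _ = _ := by
          rw [hUU, mul_one, mul_one, diagonal_mul_diagonal, diagonal_mul_diagonal]
    rw [e, le_iff, ← diagonal_one, diagonal_sub, posSemidef_diagonal_iff]
    intro i
    rw [← hss i]
    by_cases h : s i = 0
    · simp [h]
    · simp [h]
  · intro Y hY hYξ
    set R := U * diagonal s⁻¹ * (diagonal s * Uᴴ) with hR
    suffices h : Y * R = Y by
      have h2 : Rᴴ * Y = Y := by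
        have := congrArg conjTranspose h
        rwa [conjTranspose_mul, (isHermitian_of_nonneg hY).eq] at this
      calc _ = Rᴴ * (Y * R) := by rw [hR]; simp only [conjTranspose_mul, mul_assoc]
        _ = Y := by rw [h, h2]
    have hξR : ξ * (1 - R) = 0 := by
      rw [hspec, hR, mul_sub, mul_one, sub_eq_zero]
      symm
      calc _ = U * diagonal (fun i => (p i : ℂ)) * (Uᴴ * U) * diagonal s⁻¹ * diagonal s * Uᴴ := by
            simp only [mul_assoc]
        _ = _ := by
          rw [hUU, mul_one, mul_assoc U, mul_assoc U, diagonal_mul_diagonal, diagonal_mul_diagonal]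
          congr 3
          ext i
          rw [← hss i]
          by_cases h : s i = 0
          · simp [h]
          · simp [h]
    have hYR : Y * (1 - R) = 0 := by
      have key : ∀ x : V → ℂ, Y *ᵥ ((1 - R) *ᵥ x) = 0 := by
        intro x
        rw [← (nonneg_iff_posSemidef.1 hY).dotProduct_mulVec_zero_iff,
          qform_eq _ (isHermitian_of_nonneg hY)]
        have h1 := qform_mono ((1 - R) *ᵥ x) hYξ
        have h2 := qform_nonneg ((1 - R) *ᵥ x) hY
        have h3 : qform ((1 - R) *ᵥ x) ξ = 0 := by
          rw [qform_apply, mulVec_mulVec, hξR]; simp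
        exact_mod_cast le_antisymm (h1.trans h3.le) h2
      ext i j
      have := congrFun (key (Pi.single j 1)) i
      rw [mulVec_mulVec] at this
      simpa using this
    rw [mul_sub, mul_one, sub_eq_zero] at hYR
    exact hYR.symm

lemma L2Bound.le_sqrt {X : Type} [Fintype X] {L : ℝ} {ξ : X → Matrix V V ℂ} (h : L2Bound L ξ)
    {g : X → ℝ} (hg : ∀ x, 0 ≤ g x) :
    ∑ x, g x • ξ x ≤ (L * Real.sqrt (∑ x, g x ^ 2)) • ∑ x, ξ x := by
  set s := ∑ x, g x ^ 2 with hs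
  have hs0 : 0 ≤ s := Finset.sum_nonneg fun x _ => sq_nonneg _
  rcases hs0.eq_or_lt with h0 | hpos
  · have hz : ∀ x, g x = 0 := fun x => by
      have := (Finset.sum_eq_zero_iff_of_nonneg fun x _ => sq_nonneg (g x)).1 h0.symm x
        (Finset.mem_univ x)
      exact pow_eq_zero_iff two_ne_zero |>.1 this
    simp [hz, ← h0]
  have hr := Real.sqrt_pos.2 hpos
  have h1 := h (fun x => (Real.sqrt s)⁻¹ * g x)
    (fun x => mul_nonneg (inv_nonneg.2 hr.le) (hg x))
    (by
      simp only [mul_pow, ← Finset.mul_sum, inv_pow, Real.sq_sqrt hs0]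
      rw [inv_mul_cancel₀ hpos.ne'])
  have h2 := smul_le_smul_matrix hr.le h1
  simp only [Finset.smul_sum, smul_smul, mul_inv_cancel_left₀ hr.ne'] at h2 ⊢
  rwa [mul_comm L]

lemma qform_one_eq [DecidableEq V] (v : V → ℂ) : qform v (1 : Matrix V V ℂ) = ∑ i, ‖v i‖ ^ 2 := by
  rw [qform_apply, one_mulVec, dotProduct, Complex.re_sum]
  refine Finset.sum_congr rfl fun i _ => ?_
  rw [Pi.star_apply, Complex.star_def, ← Complex.normSq_eq_conj_mul_self, Complex.ofReal_re,
    Complex.normSq_eq_norm_sq]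

lemma le_reTrace_smul_one [DecidableEq V] {Y : Matrix V V ℂ} (hY : 0 ≤ Y) :
    Y ≤ reTrace Y • (1 : Matrix V V ℂ) := by
  refine le_of_qform (isHermitian_of_nonneg hY) ?_ fun v => ?_
  · simp [IsHermitian, conjTranspose_smul]
  by_cases hv : v = 0
  · simp [hv, qform_apply]
  obtain ⟨c, hc, hcv⟩ := exists_normalize hv
  have h := qform_le_reTrace hcv hY
  rw [qform_smul] at h
  have h1 : c ^ 2 * qform v (1 : Matrix V V ℂ) = 1 := by
    rw [← qform_smul, qform_apply, one_mulVec, hcv]; simp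
  rw [map_smul, smul_eq_mul]
  have h2 : 0 < c ^ 2 := by positivity
  have h3 : c ^ 2 * qform v Y ≤ c ^ 2 * (reTrace Y * qform v 1) := by
    calc _ ≤ reTrace Y * 1 := by simpa using h
      _ = _ := by rw [← h1]; ring
  exact le_of_mul_le_mul_left h3 h2

/-- If the conditional distributions have small `ℓ₂`-norm, then after removing a set of values of
`x` of small total weight the remaining conditional min-entropy is large. -/
lemma L2Bound.exists_light {X : Type} [Fintype X] {L lam γ : ℝ} {ξ : X → Matrix V V ℂ}
    (h : L2Bound L ξ) (hξ : ∀ x, 0 ≤ ξ x) (hL : 0 ≤ L) (hlam : 0 < lam)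
    (hγ : Fintype.card V * L ^ 2 ≤ γ * lam) :
    ∃ S : Finset X, ∑ x ∈ S, ξ x ≤ γ • ∑ x, ξ x ∧ ∀ x, x ∉ S → ξ x ≤ lam • ∑ y, ξ y := by
  have hpos : 0 ≤ ∑ x, ξ x := Finset.sum_nonneg fun x _ => hξ x
  obtain ⟨Q, C, hC, hQ, hQC⟩ := exists_whitening hpos
  set u : V → V → ℂ := fun j => Q *ᵥ Pi.single j 1 with hu
  have hqf : ∀ (Y : Matrix V V ℂ) j, qform (Pi.single j 1) (Qᴴ * Y * Q) = qform (u j) Y := by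
    intro Y j
    have := qform_sandwich Qᴴ Y (Pi.single j 1)
    rwa [sandwich_apply, conjTranspose_conjTranspose] at this
  have htr : ∀ Y : Matrix V V ℂ, reTrace (Qᴴ * Y * Q) = ∑ j, qform (u j) Y := by
    intro Y
    simp only [← hqf, reTrace_apply, Matrix.trace, Complex.re_sum, qform_apply]
    refine Finset.sum_congr rfl fun j _ => ?_
    simp
  have h1 : ∀ j, qform (u j) (∑ x, ξ x) ≤ 1 := fun j => by
    rw [← hqf]
    refine (qform_mono _ hQ).trans ?_
    rw [qform_apply]; simp
  set n : V → X → ℝ := fun j x => qform (u j) (ξ x) with hn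
  have hn0 : ∀ j x, 0 ≤ n j x := fun j x => qform_nonneg _ (hξ x)
  have hnL : ∀ j, Real.sqrt (∑ x, n j x ^ 2) ≤ L := by
    intro j
    have h2 := qform_mono (u j) (h.le_sqrt (hn0 j))
    simp only [map_sum, map_smul, smul_eq_mul] at h2
    have h3 : ∑ x, qform (u j) (ξ x) ≤ 1 := by rw [← map_sum]; exact h1 j
    have h4 : ∑ x, n j x ^ 2 ≤ L * Real.sqrt (∑ x, n j x ^ 2) := by
      calc _ = ∑ x, n j x * qform (u j) (ξ x) := Finset.sum_congr rfl fun x _ => by rw [sq]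
        _ ≤ _ := h2
        _ ≤ _ := mul_le_of_le_one_right (by positivity) h3
    by_contra hcon
    push Not at hcon
    have h5 := Real.mul_self_sqrt (Finset.sum_nonneg fun x (_ : x ∈ Finset.univ) => sq_nonneg (n j x))
    nlinarith
  have h2 : ∀ j, ∑ x, n j x • ξ x ≤ L ^ 2 • ∑ x, ξ x := fun j =>
    (h.le_sqrt (hn0 j)).trans (smul_le_smul_right_matrix
      (by rw [sq]; exact mul_le_mul_of_nonneg_left (hnL j) hL) hpos)
  set t : X → ℝ := fun x => ∑ j, n j x with ht
  have ht0 : ∀ x, 0 ≤ t x := fun x => Finset.sum_nonneg fun j _ => hn0 j x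
  have h3 : ∑ x, t x • ξ x ≤ (Fintype.card V * L ^ 2) • ∑ x, ξ x := by
    have := Finset.sum_le_sum fun j (_ : j ∈ (Finset.univ : Finset V)) => h2 j
    rw [Finset.sum_comm, Finset.sum_const, Finset.card_univ, ← Nat.cast_smul_eq_nsmul ℝ,
      smul_smul] at this
    simpa only [ht, Finset.sum_smul] using this
  refine ⟨Finset.univ.filter fun x => lam < t x, ?_, fun x hx => ?_⟩
  · have h4 : lam • ∑ x with lam < t x, ξ x ≤ ∑ x, t x • ξ x := by
      rw [Finset.smul_sum]
      refine (Finset.sum_le_sum fun x hx => smul_le_smul_right_matrix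
        (Finset.mem_filter.1 hx).2.le (hξ x)).trans ?_
      exact Finset.sum_le_sum_of_subset_of_nonneg (Finset.filter_subset _ _)
        fun x _ _ => smul_nonneg_matrix (ht0 x) (hξ x)
    have h5 := smul_le_smul_matrix (inv_nonneg.2 hlam.le)
      ((h4.trans h3).trans (smul_le_smul_right_matrix hγ hpos))
    rw [smul_smul, smul_smul, inv_mul_cancel₀ hlam.ne', one_smul] at h5
    rwa [mul_comm γ, inv_mul_cancel_left₀ hlam.ne'] at h5
  · have hx' : t x ≤ lam := by simpa using hx
    refine le_trans ?_ (smul_le_smul_right_matrix hx' hpos)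
    have hle : ξ x ≤ ∑ y, ξ y := Finset.single_le_sum (fun y _ => hξ y) (Finset.mem_univ x)
    have hN : 0 ≤ Qᴴ * ξ x * Q := by
      have := sandwich_nonneg Qᴴ (hξ x)
      rwa [sandwich_apply, conjTranspose_conjTranspose] at this
    have h6 := map_le_of_nonneg (sandwich Cᴴ) (fun _ => sandwich_nonneg _) (le_reTrace_smul_one hN)
    rw [map_smul, sandwich_apply, sandwich_apply, conjTranspose_conjTranspose, hQC _ (hξ x) hle,
      mul_one, hC, htr] at h6
    exact h6

/-- The five numbers `0, ±1, ±i`, which suffice for polarization. -/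
def phase : Fin 5 → ℂ := ![0, 1, -1, Complex.I, -Complex.I]

lemma norm_phase_le (s : Fin 5) : ‖phase s‖ ≤ 1 := by
  fin_cases s <;> simp [phase]

lemma qform_add_add_qform_sub (N : Matrix V V ℂ) (c u : V → ℂ) :
    qform (c + u) N + qform (c - u) N - 2 * qform c N = 2 * qform u N := by
  simp only [qform_apply, star_add, star_sub, mulVec_add, mulVec_sub, add_dotProduct,
    sub_dotProduct, dotProduct_add, dotProduct_sub, Complex.add_re, Complex.sub_re]
  ring

lemma qform_polarization {N : Matrix V V ℂ} (hN : N.IsHermitian) (c u w : V → ℂ) :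
    qform (c + u + w) N - qform (c + u - w) N - qform (c - u + w) N + qform (c - u - w) N
      = 8 * (star u ⬝ᵥ (N *ᵥ w)).re := by
  have h : (star w ⬝ᵥ (N *ᵥ u)).re = (star u ⬝ᵥ (N *ᵥ w)).re := by
    rw [← Complex.conj_re, ← Complex.star_def, star_dotProduct, star_star, star_mulVec, hN.eq,
      ← dotProduct_mulVec]
  simp only [qform_apply, star_add, star_sub, mulVec_add, mulVec_sub, add_dotProduct,
    sub_dotProduct, dotProduct_add, dotProduct_sub, Complex.add_re, Complex.sub_re, h]
  ring

lemma phase_update [DecidableEq V] (g : V → Fin 5) (i : V) (s : Fin 5) :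
    (fun k => phase (Function.update g i s k))
      = (fun k => phase (Function.update g i 0 k)) + phase s • Pi.single i 1 := by
  ext k
  by_cases h : k = i
  · subst h; simp [phase]
  · simp [h]

/-- A Hermitian matrix with a large entry has a large quadratic form at one of the vectors obtained
by varying two coordinates. -/
lemma exists_phase_of_entry {N : Matrix V V ℂ} (hN : N.IsHermitian) {θ : ℝ}
    {i j : V} (hij : 2 * θ < ‖N i j‖) (g : V → Fin 5) :
    ∃ s t, θ ≤ |qform (fun k => phase (Function.update (Function.update g i s) j t k)) N| := by
  by_contra! hcon
  by_cases h : i = j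
  · subst h
    have h0 := hcon 0 0
    have h1 := hcon 0 1
    have h2 := hcon 0 2
    simp only [Function.update_idem] at h0 h1 h2
    rw [phase_update, show phase 1 = 1 from rfl, one_smul] at h1
    rw [phase_update, show phase 2 = -1 from rfl, neg_one_smul, ← sub_eq_add_neg] at h2
    have key := qform_add_add_qform_sub N (fun k => phase (Function.update g i 0 k))
      (Pi.single i 1)
    have h3 : qform (Pi.single i 1) N = (N i i).re := by rw [qform_apply]; simp
    have h4 : (N i i).im = 0 := by
      have := congrArg Complex.im (hN.apply i i)
      simp at this
      linarith
    have h5 : ‖N i i‖ = |(N i i).re| := by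
      rw [← Complex.re_add_im (N i i), h4]; simp
    rw [h3] at key
    rw [h5] at hij
    rw [abs_lt] at h0 h1 h2
    rcases lt_abs.1 hij with h | h <;> linarith
  · have hexp : ∀ s t, (fun k => phase (Function.update (Function.update g i s) j t k))
        = (fun k => phase (Function.update (Function.update g i 0) j 0 k))
          + phase s • Pi.single i 1 + phase t • Pi.single j 1 := by
      intro s t
      rw [phase_update, Function.update_comm h, phase_update, Function.update_comm (Ne.symm h)]
    have hone : phase 1 = 1 := rfl
    have htwo : phase 2 = -1 := rfl
    have hthree : phase 3 = Complex.I := rfl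
    have hfour : phase 4 = -Complex.I := rfl
    set c := (fun k => phase (Function.update (Function.update g i 0) j 0 k))
    have hc : ∀ s t, |qform (c + phase s • Pi.single i 1 + phase t • Pi.single j 1) N| < θ :=
      fun s t => by rw [← hexp]; exact hcon s t
    have k1 := qform_polarization hN c (Pi.single i 1) (Pi.single j 1)
    have k2 := qform_polarization hN c (Pi.single i 1) (Complex.I • Pi.single j 1)
    have a1 := hc 1 1
    have a2 := hc 1 2
    have a3 := hc 2 1
    have a4 := hc 2 2
    have b1 := hc 1 3
    have b2 := hc 1 4
    have b3 := hc 2 3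
    have b4 := hc 2 4
    simp only [hone, htwo, hthree, hfour, one_smul, neg_smul, ← sub_eq_add_neg]
      at a1 a2 a3 a4 b1 b2 b3 b4
    have e1 : (star (Pi.single i 1 : V → ℂ) ⬝ᵥ (N *ᵥ Pi.single j 1)).re = (N i j).re := by simp
    have e2 : (star (Pi.single i 1 : V → ℂ) ⬝ᵥ (N *ᵥ (Complex.I • Pi.single j 1))).re
        = -(N i j).im := by simp [mulVec_smul]
    rw [e1] at k1
    rw [e2] at k2
    have h5 := Complex.norm_le_abs_re_add_abs_im (N i j)
    rw [abs_lt] at a1 a2 a3 a4 b1 b2 b3 b4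
    have h6 : |(N i j).re| < θ / 2 + θ / 4 := by rw [abs_lt]; constructor <;> linarith
    have h7 : |(N i j).im| < θ / 2 + θ / 4 := by rw [abs_lt]; constructor <;> linarith
    linarith

lemma card_phase_of_entry {N : Matrix V V ℂ} (hN : N.IsHermitian) {θ : ℝ}
    {i j : V} (hij : 2 * θ < ‖N i j‖) :
    5 ^ Fintype.card V ≤
      25 * (Finset.univ.filter fun g : V → Fin 5 => θ ≤ |qform (fun k => phase (g k)) N|).card := by
  choose s t hst using exists_phase_of_entry hN hij
  have h := Finset.card_le_mul_card_image_of_maps_to (s := (Finset.univ : Finset (V → Fin 5)))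
    (f := fun g => Function.update (Function.update g i (s g)) j (t g))
    (t := Finset.univ.filter fun g : V → Fin 5 => θ ≤ |qform (fun k => phase (g k)) N|)
    (fun g _ => by simpa using hst g) 25 (fun b _ => by
      refine (Finset.card_le_card_of_injOn (t := (Finset.univ : Finset (Fin 5 × Fin 5)))
        (fun g => (g i, g j)) (fun _ _ => Finset.mem_coe.2 (Finset.mem_univ _)) ?_).trans
        (by simp)
      intro g hg g' hg' hgg
      have h1 := (Finset.mem_filter.1 hg).2
      have h2 := (Finset.mem_filter.1 hg').2
      have hi : g i = g' i := congrArg Prod.fst hgg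
      have hj : g j = g' j := congrArg Prod.snd hgg
      funext k
      by_cases hkj : k = j
      · rw [hkj, hj]
      by_cases hki : k = i
      · rw [hki, hi]
      have := congrFun (h1.trans h2.symm) k
      simpa [hkj, hki] using this)
  simpa using h

lemma abs_qform_le_of_entry {N : Matrix V V ℂ} {θ : ℝ} (hN : ∀ i j, ‖N i j‖ ≤ θ) (hθ : 0 ≤ θ)
    (c : V → ℂ) : |qform c N| ≤ θ * Fintype.card V * qform c (1 : Matrix V V ℂ) := by
  rw [qform_one_eq]
  calc |qform c N| ≤ ‖star c ⬝ᵥ (N *ᵥ c)‖ := Complex.abs_re_le_norm _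
    _ ≤ ∑ i, ∑ j, ‖c i‖ * (θ * ‖c j‖) := by
      refine (norm_sum_le _ _).trans (Finset.sum_le_sum fun i _ => ?_)
      rw [norm_mul, Pi.star_apply, norm_star, ← Finset.mul_sum]
      refine mul_le_mul_of_nonneg_left ((norm_sum_le _ _).trans (Finset.sum_le_sum fun j _ => ?_))
        (norm_nonneg _)
      rw [norm_mul]
      exact mul_le_mul_of_nonneg_right (hN i j) (norm_nonneg _)
    _ = θ * (∑ i, ‖c i‖) ^ 2 := by
      rw [sq, Finset.sum_mul_sum, Finset.mul_sum]
      refine Finset.sum_congr rfl fun i _ => ?_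
      rw [Finset.mul_sum]
      exact Finset.sum_congr rfl fun j _ => by ring
    _ ≤ _ := by
      rw [mul_assoc]
      refine mul_le_mul_of_nonneg_left ?_ hθ
      simpa using sq_sum_le_card_mul_sum_sq (s := (Finset.univ : Finset V)) (f := fun i => ‖c i‖)

/-- If few rows are biased on the distribution conditioned on any single measurement outcome, then
few rows are biased as matrices. -/
lemma card_biased_le [Nonempty V] {A X : Type} [Fintype A] [Fintype X] (M : A → X → ℝ)
    {ξ : X → Matrix V V ℂ} (hξ : ∀ x, 0 ≤ ξ x) {e δ : ℝ} (he : 0 < e) (hδ : 0 ≤ δ)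
    (H : ∀ u, 0 < qform u (∑ x, ξ x) →
      ((Finset.univ.filter fun a => e ≤ |∑ x, M a x * (qform u (ξ x) / qform u (∑ y, ξ y))|).card : ℝ)
        ≤ δ) :
    ((Finset.univ.filter fun a => ¬ (∑ x, M a x • ξ x ≤ (2 * Fintype.card V ^ 2 * e) • ∑ x, ξ x ∧
      -((2 * Fintype.card V ^ 2 * e) • ∑ x, ξ x) ≤ ∑ x, M a x • ξ x)).card : ℝ) ≤ 25 * δ := by
  have hpos : 0 ≤ ∑ x, ξ x := Finset.sum_nonneg fun x _ => hξ x
  obtain ⟨Q, C, hC, hQ, hQC⟩ := exists_whitening hpos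
  set d : ℝ := (Fintype.card V : ℝ) with hd
  have hd0 : 0 < d := by rw [hd]; exact_mod_cast Fintype.card_pos
  set θ := d * e with hθ
  have hθ0 : 0 < θ := by positivity
  set β : A → Matrix V V ℂ := fun a => ∑ x, M a x • ξ x with hβ
  have hβH : ∀ a, (β a).IsHermitian := fun a => by
    rw [IsHermitian, hβ]
    simp only [conjTranspose_sum, conjTranspose_smul, star_trivial]
    exact Finset.sum_congr rfl fun x _ => by rw [(isHermitian_of_nonneg (hξ x)).eq]
  set N : A → Matrix V V ℂ := fun a => sandwich Qᴴ (β a) with hN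
  have hNH : ∀ a, (N a).IsHermitian := fun a => by
    rw [hN]; simp only [sandwich_apply]
    exact isHermitian_mul_mul_conjTranspose _ (hβH a)
  have hNβ : ∀ a, sandwich Cᴴ (N a) = β a := fun a => by
    simp only [hN, hβ, map_sum, map_smul]
    refine Finset.sum_congr rfl fun x _ => ?_
    have := hQC (ξ x) (hξ x) (Finset.single_le_sum (fun y _ => hξ y) (Finset.mem_univ x))
    rw [sandwich_apply, sandwich_apply, conjTranspose_conjTranspose, conjTranspose_conjTranspose,
      this]
  have hentry : ∀ a, (∀ i j, ‖N a i j‖ ≤ 2 * θ) →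
      (β a ≤ (2 * d ^ 2 * e) • ∑ x, ξ x ∧ -((2 * d ^ 2 * e) • ∑ x, ξ x) ≤ β a) := by
    intro a ha
    have h1 := abs_qform_le_of_entry ha (by positivity)
    have h2 : (2 * θ * d) = 2 * d ^ 2 * e := by rw [hθ]; ring
    rw [← hd, h2] at h1
    have hsm : ((2 * d ^ 2 * e) • (1 : Matrix V V ℂ)).IsHermitian := by
      simp [IsHermitian, conjTranspose_smul]
    have h3 : sandwich Cᴴ ((2 * d ^ 2 * e) • (1 : Matrix V V ℂ)) = (2 * d ^ 2 * e) • ∑ x, ξ x := by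
      rw [map_smul, sandwich_apply, conjTranspose_conjTranspose, mul_one, hC]
    rw [← hNβ, ← h3, ← map_neg]
    constructor
    · refine map_le_of_nonneg _ (fun _ => sandwich_nonneg _) (le_of_qform (hNH a) hsm fun v => ?_)
      rw [map_smul, smul_eq_mul]
      exact (abs_le.1 (h1 v)).2
    · refine map_le_of_nonneg _ (fun _ => sandwich_nonneg _)
        (le_of_qform hsm.neg (hNH a) fun v => ?_)
      rw [map_neg, map_smul, smul_eq_mul]
      exact (abs_le.1 (h1 v)).1
  set bad := Finset.univ.filter fun a => ¬ (β a ≤ (2 * d ^ 2 * e) • ∑ x, ξ x ∧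
      -((2 * d ^ 2 * e) • ∑ x, ξ x) ≤ β a) with hbad
  set G : Finset (V → Fin 5) := Finset.univ
  have hG : (G.card : ℝ) = 5 ^ Fintype.card V := by simp [G]
  have h1 : ∀ a ∈ bad, (G.card : ℝ) ≤
      25 * ((G.filter fun g => θ ≤ |qform (fun k => phase (g k)) (N a)|).card : ℝ) := by
    intro a ha
    have h2 : ∃ i j, 2 * θ < ‖N a i j‖ := by
      by_contra! hcon
      exact (Finset.mem_filter.1 ha).2 (hentry a hcon)
    obtain ⟨i, j, hij⟩ := h2
    rw [hG]
    exact_mod_cast card_phase_of_entry (hNH a) hij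
  have h2 : ∀ g ∈ G,
      ((bad.filter fun a => θ ≤ |qform (fun k => phase (g k)) (N a)|).card : ℝ) ≤ δ := by
    intro g _
    set v : V → ℂ := fun k => phase (g k) with hv
    set u := Q *ᵥ v with hu
    have hq : ∀ Y, qform v (sandwich Qᴴ Y) = qform u Y := fun Y => by
      rw [qform_sandwich, conjTranspose_conjTranspose]
    have hqd : qform u (∑ x, ξ x) ≤ d := by
      rw [← hq, sandwich_apply, conjTranspose_conjTranspose]
      refine (qform_mono v hQ).trans ?_
      rw [qform_one_eq, hd]
      calc ∑ i, ‖v i‖ ^ 2 ≤ ∑ _i : V, (1 : ℝ) := Finset.sum_le_sum fun i _ =>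
            pow_le_one₀ (norm_nonneg _) (norm_phase_le _)
        _ = _ := by simp
    have hNa : ∀ a, qform v (N a) = ∑ x, M a x * qform u (ξ x) := fun a => by
      simp only [hN, hq, hβ, map_sum, map_smul, smul_eq_mul]
    rcases (qform_nonneg u hpos).eq_or_lt with h0 | hpos'
    · have hz : ∀ x, qform u (ξ x) = 0 := by
        rw [map_sum] at h0
        intro x
        exact (Finset.sum_eq_zero_iff_of_nonneg fun x _ => qform_nonneg u (hξ x)).1 h0.symm x
          (Finset.mem_univ x)
      have : bad.filter (fun a => θ ≤ |qform v (N a)|) = ∅ := by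
        refine Finset.filter_false_of_mem fun a _ => ?_
        rw [hNa]; simp [hz, hθ0]
      rw [this]; simpa using hδ
    · refine le_trans ?_ (H u hpos')
      refine Nat.cast_le.2 (Finset.card_le_card fun a ha => ?_)
      have ha' := (Finset.mem_filter.1 ha).2
      refine Finset.mem_filter.2 ⟨Finset.mem_univ _, ?_⟩
      have h3 : ∑ x, M a x * (qform u (ξ x) / qform u (∑ y, ξ y))
          = qform v (N a) / qform u (∑ y, ξ y) := by
        rw [hNa, Finset.sum_div]
        exact Finset.sum_congr rfl fun x _ => by ring
      rw [h3, abs_div, abs_of_pos hpos', le_div_iff₀ hpos']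
      calc _ ≤ e * d := mul_le_mul_of_nonneg_left hqd he.le
        _ = θ := by rw [hθ]; ring
        _ ≤ _ := ha'
  have h3 : (bad.card : ℝ) * G.card ≤ 25 * (G.card * δ) := by
    calc (bad.card : ℝ) * G.card = ∑ a ∈ bad, (G.card : ℝ) := by simp
      _ ≤ ∑ a ∈ bad,
          25 * ((G.filter fun g => θ ≤ |qform (fun k => phase (g k)) (N a)|).card : ℝ) :=
        Finset.sum_le_sum h1
      _ = 25 * ∑ g ∈ G,
          ((bad.filter fun a => θ ≤ |qform (fun k => phase (g k)) (N a)|).card : ℝ) := by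
        rw [← Finset.mul_sum]
        congr 1
        exact_mod_cast Finset.sum_card_bipartiteAbove_eq_sum_card_bipartiteBelow
          (s := bad) (t := G) (fun a g => θ ≤ |qform (fun k => phase (g k)) (N a)|)
      _ ≤ 25 * ∑ g ∈ G, δ := mul_le_mul_of_nonneg_left (Finset.sum_le_sum h2) (by norm_num)
      _ = _ := by simp
  have hGpos : (0 : ℝ) < G.card := by rw [hG]; positivity
  have h4 : (bad.card : ℝ) * G.card ≤ (25 * δ) * G.card := by linarith
  exact le_of_mul_le_mul_right h4 hGpos

/-- A quantum instrument on `V` controlled by, and with outcome in, a classical register `W`. -/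
structure IsInstrument {W : Type} [Fintype W] (Ψ : W → W → Matrix V V ℂ →ₗ[ℝ] Matrix V V ℂ) :
    Prop where
  nonneg : ∀ w w' Y, 0 ≤ Y → 0 ≤ Ψ w w' Y
  sum_le : ∀ w Y, 0 ≤ Y → ∑ w', reTrace (Ψ w w' Y) ≤ reTrace Y

/-- `Z` bounds the total over the classical register of the measured Rényi quantities. -/
def TotalRenyiBound {W : Type} [Fintype W] (k : ℕ) (σ τ : W → Matrix V V ℂ) (Z : ℝ) : Prop :=
  ∃ B : W → ℝ, (∀ w, RenyiBound k (σ w) (τ w) (B w)) ∧ ∑ w, B w ≤ Z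

lemma exists_bounds_of_sum_le {W : Type} [Fintype W] {S : W → Set ℝ} (h0 : ∀ w, (0 : ℝ) ∈ S w)
    {Z : ℝ} (h : ∀ s : W → ℝ, (∀ w, s w ∈ S w) → ∑ w, s w ≤ Z) :
    ∃ B : W → ℝ, (∀ w, ∀ s ∈ S w, s ≤ B w) ∧ ∑ w, B w ≤ Z := by
  have hb : ∀ w, BddAbove (S w) := fun w => ⟨Z, fun s hs => by
    have := h (Pi.single w s) (fun w' => by
      by_cases hw : w' = w
      · subst hw; simpa using hs
      · simpa [hw] using h0 w')
    simpa using this⟩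
  refine ⟨fun w => sSup (S w), fun w s hs => le_csSup (hb w) hs, ?_⟩
  refine le_of_forall_pos_le_add fun ε hε => ?_
  have hε' : 0 < ε / (Fintype.card W + 1) := by positivity
  choose s hs hs' using fun w => exists_lt_of_lt_csSup ⟨0, h0 w⟩
    (sub_lt_self (sSup (S w)) hε')
  calc ∑ w, sSup (S w) ≤ ∑ w, (s w + ε / (Fintype.card W + 1)) :=
        Finset.sum_le_sum fun w _ => by have := hs' w; linarith
    _ = ∑ w, s w + Fintype.card W * (ε / (Fintype.card W + 1)) := by
        rw [Finset.sum_add_distrib]; simp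
    _ ≤ Z + ε := by
        refine add_le_add (h s hs) ?_
        rw [mul_div_assoc', div_le_iff₀ (by positivity)]
        nlinarith

lemma totalRenyiBound_of_forall {W : Type} [Fintype W] {k : ℕ} {σ τ : W → Matrix V V ℂ} {Z : ℝ}
    (h : ∀ (ι : W → Type) [∀ w, Fintype (ι w)] (e : ∀ w, ι w → Matrix V V ℂ →ₗ[ℝ] ℝ)
      (c : ∀ w, ι w → ℝ), (∀ w, IsSubMeasurement (e w)) → (∀ w i, 0 ≤ c w i) →
        ∑ w, ∑ i, ((k + 1) * c w i ^ k * e w i (σ w) - k * c w i ^ (k + 1) * e w i (τ w)) ≤ Z) :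
    TotalRenyiBound k σ τ Z := by
  let S : W → Set ℝ := fun w => {r | ∃ (ι : Type) (_ : Fintype ι)
    (e : ι → Matrix V V ℂ →ₗ[ℝ] ℝ) (c : ι → ℝ), IsSubMeasurement e ∧ (∀ i, 0 ≤ c i) ∧
      r = ∑ i, ((k + 1) * c i ^ k * e i (σ w) - k * c i ^ (k + 1) * e i (τ w))}
  obtain ⟨B, hB, hBZ⟩ := exists_bounds_of_sum_le (S := S)
    (fun w => ⟨Empty, inferInstance, fun i => i.elim, fun i => i.elim,
      ⟨fun i => i.elim, fun Y hY => by simpa using reTrace_nonneg hY⟩, fun i => i.elim, by simp⟩)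
    (Z := Z) (fun s hs => by
      choose ι inst e c he hc hr using hs
      simp only [hr]
      exact h ι e c he hc)
  exact ⟨B, fun w ι inst e c he hc => hB w _ ⟨ι, inst, e, c, he, hc, rfl⟩, hBZ⟩

/-- One step of the evolution, restricted to the pairs `(a, w)` which are `good`. -/
def stepFamily {A X W : Type} [Fintype A] [Fintype W] (M : A → X → ℝ)
    (Ψ : A → ℝ → W → W → Matrix V V ℂ →ₗ[ℝ] Matrix V V ℂ) (good : A → W → Prop)
    (π : X → W → Matrix V V ℂ) (x : X) (w' : W) : Matrix V V ℂ :=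
  (Fintype.card A : ℝ)⁻¹ • ∑ a, ∑ w, if good a w then Ψ a (M a x) w w' (π x w) else 0

lemma sum_smul_stepFamily {A X W : Type} [Fintype A] [Fintype X] [Fintype W] {M : A → X → ℝ}
    (hM : ∀ a x, M a x = 1 ∨ M a x = -1)
    (Ψ : A → ℝ → W → W → Matrix V V ℂ →ₗ[ℝ] Matrix V V ℂ) (good : A → W → Prop)
    (π : X → W → Matrix V V ℂ) (f : X → ℝ) (w' : W) :
    ∑ x, f x • stepFamily M Ψ good π x w' = (Fintype.card A : ℝ)⁻¹ • ∑ a, ∑ w,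
      if good a w then ∑ b ∈ ({1, -1} : Finset ℝ),
        Ψ a b w w' ((1 / 2 : ℝ) • (∑ x, f x • π x w + b • ∑ x, M a x • f x • π x w)) else 0 := by
  simp only [stepFamily, smul_comm (f _) ((Fintype.card A : ℝ)⁻¹), ← Finset.smul_sum]
  congr 1
  simp only [Finset.smul_sum (r := f _)]
  rw [Finset.sum_comm]
  refine Finset.sum_congr rfl fun a _ => ?_
  rw [Finset.sum_comm]
  refine Finset.sum_congr rfl fun w _ => ?_
  split_ifs
  · rw [Finset.sum_pair (by norm_num)]
    simp only [map_smul, map_add, map_sum, Finset.smul_sum, ← Finset.sum_add_distrib, smul_add]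
    refine Finset.sum_congr rfl fun x _ => ?_
    rcases hM a x with h | h
    · rw [h]; module
    · rw [h]; module
  · simp

lemma TotalRenyiBound.stepFamily {A X W : Type} [Fintype A] [Fintype X] [Fintype W]
    {M : A → X → ℝ} (hM : ∀ a x, M a x = 1 ∨ M a x = -1)
    {Ψ : A → ℝ → W → W → Matrix V V ℂ →ₗ[ℝ] Matrix V V ℂ} (hΨ : ∀ a b, IsInstrument (Ψ a b))
    {good : A → W → Prop} {π : X → W → Matrix V V ℂ} (hπ : ∀ x w, 0 ≤ π x w)
    {f : X → ℝ} (hf : ∀ x, 0 ≤ f x) {k : ℕ} {Z ε κ : ℝ} (hε0 : 0 ≤ ε) (hε : ε < 1) (hκ : 0 ≤ κ)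
    (h : TotalRenyiBound k (fun w => ∑ x, f x • π x w) (fun w => ∑ x, π x w) Z)
    (hgood : ∀ a w, good a w → ∑ x, M a x • π x w ≤ ε • ∑ x, π x w ∧
      -(ε • ∑ x, π x w) ≤ ∑ x, M a x • π x w)
    (hbad : ∀ w, ((Finset.univ.filter fun a => ¬ (∑ x, M a x • f x • π x w ≤ ε • ∑ x, f x • π x w ∧
      -(ε • ∑ x, f x • π x w) ≤ ∑ x, M a x • f x • π x w)).card : ℝ) ≤ κ * Fintype.card A) :
    TotalRenyiBound k (fun w => ∑ x, f x • _root_.stepFamily M Ψ good π x w)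
      (fun w => ∑ x, _root_.stepFamily M Ψ good π x w)
      (((1 + ε) ^ (k + 1) + κ * 2 ^ (k + 1)) / (1 - ε) ^ k * Z) := by
  obtain ⟨B, hB, hBZ⟩ := h
  have hε1 : 0 < 1 - ε := by linarith
  set σ : W → Matrix V V ℂ := fun w => ∑ x, f x • π x w with hσ
  set τ : W → Matrix V V ℂ := fun w => ∑ x, π x w with hτ
  set βσ : A → W → Matrix V V ℂ := fun a w => ∑ x, M a x • f x • π x w with hβσ
  set βτ : A → W → Matrix V V ℂ := fun a w => ∑ x, M a x • π x w with hβτ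
  set σb : A → ℝ → W → Matrix V V ℂ := fun a b w => (1 / 2 : ℝ) • (σ w + b • βσ a w) with hσb
  set τb : A → ℝ → W → Matrix V V ℂ := fun a b w => (1 / 2 : ℝ) • (τ w + b • βτ a w) with hτb
  set nice : A → W → Prop := fun a w => βσ a w ≤ ε • σ w ∧ -(ε • σ w) ≤ βσ a w with hnice
  have hB0 : ∀ w, 0 ≤ B w := fun w => (hB w).nonneg
  have hbs : ∀ b ∈ ({1, -1} : Finset ℝ), b = 1 ∨ b = -1 := fun b hb => by simpa using hb
  have hτ' : ∀ a w, good a w → ∀ b ∈ ({1, -1} : Finset ℝ), ((1 - ε) / 2) • τ w ≤ τb a b w := by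
    intro a w hg b hb
    have h1 : -(ε • τ w) ≤ b • βτ a w := by
      rcases hbs b hb with rfl | rfl
      · simpa using (hgood a w hg).2
      · simpa using (hgood a w hg).1
    have h2 := smul_le_smul_matrix (show (0 : ℝ) ≤ 1 / 2 by norm_num) (add_le_add_right h1 (τ w))
    refine le_trans (le_of_eq ?_) h2
    module
  have hσ1 : ∀ a w, ∀ b ∈ ({1, -1} : Finset ℝ), σb a b w ≤ (1 : ℝ) • σ w := by
    intro a w b hb
    have : b • βσ a w ≤ σ w := by
      simp only [hβσ, hσ, Finset.smul_sum]
      refine Finset.sum_le_sum fun x _ => ?_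
      rw [smul_smul]
      refine (smul_le_smul_right_matrix (d := 1) ?_ (smul_nonneg_matrix (hf x) (hπ x w))).trans
        (one_smul _ _).le
      rcases hbs b hb with rfl | rfl <;> rcases hM a x with h | h <;> rw [h] <;> norm_num
    have h2 := smul_le_smul_matrix (show (0 : ℝ) ≤ 1 / 2 by norm_num) (add_le_add_right this (σ w))
    refine h2.trans (le_of_eq ?_)
    module
  have hσ2 : ∀ a w, nice a w → ∀ b ∈ ({1, -1} : Finset ℝ),
      σb a b w ≤ ((1 + ε) / 2) • σ w := by
    intro a w hn b hb
    have h1 : b • βσ a w ≤ ε • σ w := by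
      rcases hbs b hb with rfl | rfl
      · simpa using hn.1
      · have := neg_le_neg hn.2
        simpa using this
    have h2 := smul_le_smul_matrix (show (0 : ℝ) ≤ 1 / 2 by norm_num) (add_le_add_right h1 (σ w))
    refine h2.trans (le_of_eq ?_)
    module
  set D : A → W → ℝ := fun a w => (if nice a w then (1 + ε) ^ (k + 1) / (1 - ε) ^ k else
    2 ^ (k + 1) / (1 - ε) ^ k) * B w with hD
  have hRB : ∀ a w, good a w → ∀ b ∈ ({1, -1} : Finset ℝ),
      RenyiBound k (σb a b w) (τb a b w) (D a w / 2) := by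
    intro a w hg b hb
    by_cases hn : nice a w
    · have := (hB w).mono (α := (1 + ε) / 2) (β := (1 - ε) / 2) (by positivity) (by positivity)
        (hσ2 a w hn b hb) (hτ' a w hg b hb)
      convert this using 1
      simp only [hD, if_pos hn, div_pow, pow_succ]
      field_simp
    · have := (hB w).mono (α := 1) (β := (1 - ε) / 2) one_pos (by positivity)
        (hσ1 a w b hb) (hτ' a w hg b hb)
      convert this using 1
      simp only [hD, if_neg hn, div_pow, one_pow, pow_succ]
      field_simp
  have hD0 : ∀ a w, 0 ≤ D a w := fun a w => by
    refine mul_nonneg ?_ (hB0 w)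
    split_ifs <;> positivity
  apply totalRenyiBound_of_forall
  intro ι _ e c he hc
  let JS : (W → Matrix V V ℂ) →ₗ[ℝ] ℝ := ∑ w, ∑ i, ((k + 1) * c w i ^ k) • (e w i).comp
    (LinearMap.proj w)
  let JT : (W → Matrix V V ℂ) →ₗ[ℝ] ℝ := ∑ w, ∑ i, (k * c w i ^ (k + 1)) • (e w i).comp
    (LinearMap.proj w)
  have hJ : ∀ σ' τ' : W → Matrix V V ℂ,
      ∑ w, ∑ i, ((k + 1) * c w i ^ k * e w i (σ' w) - k * c w i ^ (k + 1) * e w i (τ' w))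
        = JS σ' - JT τ' := by
    intro σ' τ'
    simp [JS, JT, LinearMap.sum_apply, Finset.sum_sub_distrib]
  have hJb : ∀ a w, good a w → ∀ b ∈ ({1, -1} : Finset ℝ),
      JS (fun w' => Ψ a b w w' (σb a b w)) - JT (fun w' => Ψ a b w w' (τb a b w)) ≤ D a w / 2 := by
    intro a w hg b hb
    rw [← hJ, ← Fintype.sum_sigma (fun p : (w' : W) × ι w' => (k + 1) * c p.1 p.2 ^ k * e p.1 p.2 (Ψ a b w p.1 (σb a b w))
        - k * c p.1 p.2 ^ (k + 1) * e p.1 p.2 (Ψ a b w p.1 (τb a b w)))]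
    refine hRB a w hg b hb ((w' : W) × ι w') (fun p => (e p.1 p.2).comp (Ψ a b w p.1))
      (fun p => c p.1 p.2) ⟨fun p Y hY => (he p.1).nonneg _ _ ((hΨ a b).nonneg _ _ _ hY),
        fun Y hY => ?_⟩ (fun p => hc _ _)
    rw [Fintype.sum_sigma]
    refine le_trans (Finset.sum_le_sum fun w' _ => ?_) ((hΨ a b).sum_le w Y hY)
    exact (he w').sum_le _ ((hΨ a b).nonneg _ _ _ hY)
  have hσ' : (fun w' => ∑ x, f x • _root_.stepFamily M Ψ good π x w') = (Fintype.card A : ℝ)⁻¹ •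
      ∑ a, ∑ w, if good a w then ∑ b ∈ ({1, -1} : Finset ℝ),
        (fun w' => Ψ a b w w' (σb a b w)) else 0 := by
    ext1 w'
    rw [sum_smul_stepFamily hM]
    simp only [Pi.smul_apply, Finset.sum_apply, apply_ite (fun F : W → Matrix V V ℂ => F w'),
      Pi.zero_apply, hσb, hσ, hβσ]
  have hτ'' : (fun w' => ∑ x, _root_.stepFamily M Ψ good π x w') = (Fintype.card A : ℝ)⁻¹ •
      ∑ a, ∑ w, if good a w then ∑ b ∈ ({1, -1} : Finset ℝ),
        (fun w' => Ψ a b w w' (τb a b w)) else 0 := by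
    ext1 w'
    have := sum_smul_stepFamily hM Ψ good π (fun _ => 1) w'
    simp only [one_smul] at this
    rw [this]
    simp only [Pi.smul_apply, Finset.sum_apply, apply_ite (fun F : W → Matrix V V ℂ => F w'),
      Pi.zero_apply, hτb, hτ, hβτ]
  rw [hJ, hσ', hτ'', map_smul, map_smul, map_sum, map_sum, ← smul_sub, ← Finset.sum_sub_distrib]
  have hterm : ∀ a w, JS (if good a w then ∑ b ∈ ({1, -1} : Finset ℝ),
        (fun w' => Ψ a b w w' (σb a b w)) else 0) - JT (if good a w then
        ∑ b ∈ ({1, -1} : Finset ℝ), (fun w' => Ψ a b w w' (τb a b w)) else 0) ≤ D a w := by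
    intro a w
    split_ifs with hg
    · rw [map_sum, map_sum, ← Finset.sum_sub_distrib]
      refine (Finset.sum_le_sum (hJb a w hg)).trans (le_of_eq ?_)
      rw [Finset.sum_pair (by norm_num)]
      ring
    · simpa using hD0 a w
  have hsumD : ∀ w, ∑ a, D a w ≤
      Fintype.card A * (((1 + ε) ^ (k + 1) + κ * 2 ^ (k + 1)) / (1 - ε) ^ k * B w) := by
    intro w
    have h1 : ∀ a, D a w ≤ (1 + ε) ^ (k + 1) / (1 - ε) ^ k * B w +
        (if ¬ nice a w then 2 ^ (k + 1) / (1 - ε) ^ k * B w else 0) := by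
      intro a
      have := hB0 w
      have h3 : 0 ≤ (1 + ε) ^ (k + 1) / (1 - ε) ^ k * B w := by positivity
      by_cases hn : nice a w
      · simp [hD, hn]
      · simp [hD, hn, h3]
    refine (Finset.sum_le_sum fun a _ => h1 a).trans ?_
    rw [Finset.sum_add_distrib, ← Finset.sum_filter, Finset.sum_const, Finset.sum_const,
      nsmul_eq_mul, nsmul_eq_mul, Finset.card_univ]
    have h2 := mul_le_mul_of_nonneg_right (hbad w)
      (show 0 ≤ 2 ^ (k + 1) / (1 - ε) ^ k * B w from by have := hB0 w; positivity)
    have e : (Fintype.card A : ℝ) * (((1 + ε) ^ (k + 1) + κ * 2 ^ (k + 1)) / (1 - ε) ^ k * B w)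
      = Fintype.card A * ((1 + ε) ^ (k + 1) / (1 - ε) ^ k * B w)
        + κ * Fintype.card A * (2 ^ (k + 1) / (1 - ε) ^ k * B w) := by ring
    rw [e]
    exact add_le_add_right h2 _
  have hG0 : 0 ≤ ((1 + ε) ^ (k + 1) + κ * 2 ^ (k + 1)) / (1 - ε) ^ k := by positivity
  have htot : ∑ a, (JS (∑ w, if good a w then ∑ b ∈ ({1, -1} : Finset ℝ),
        (fun w' => Ψ a b w w' (σb a b w)) else 0) - JT (∑ w, if good a w then
        ∑ b ∈ ({1, -1} : Finset ℝ), (fun w' => Ψ a b w w' (τb a b w)) else 0)) ≤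
      Fintype.card A * (((1 + ε) ^ (k + 1) + κ * 2 ^ (k + 1)) / (1 - ε) ^ k * Z) := by
    calc _ ≤ ∑ a, ∑ w, D a w := Finset.sum_le_sum fun a _ => by
          rw [map_sum, map_sum, ← Finset.sum_sub_distrib]
          exact Finset.sum_le_sum fun w _ => hterm a w
      _ = ∑ w, ∑ a, D a w := Finset.sum_comm
      _ ≤ ∑ w, Fintype.card A * (((1 + ε) ^ (k + 1) + κ * 2 ^ (k + 1)) / (1 - ε) ^ k * B w) :=
          Finset.sum_le_sum fun w _ => hsumD w
      _ = Fintype.card A * (((1 + ε) ^ (k + 1) + κ * 2 ^ (k + 1)) / (1 - ε) ^ k * ∑ w, B w) := by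
          rw [Finset.mul_sum, Finset.mul_sum]
      _ ≤ _ := by gcongr
  rw [smul_eq_mul]
  rcases (Nat.cast_nonneg (α := ℝ) (Fintype.card A)).eq_or_lt with hA | hA
  · rw [← hA]; simp only [_root_.inv_zero, zero_mul]
    have : 0 ≤ Z := (Finset.sum_nonneg fun w _ => hB0 w).trans hBZ
    positivity
  · rwa [inv_mul_le_iff₀ hA]

/-- Up to an error of total trace `e`, the family `R` is at most `c` times the family `π`. -/
def ApproxLe {X W : Type} [Fintype X] [Fintype W] (R π : X → W → Matrix V V ℂ) (c e : ℝ) : Prop :=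
  ∃ E : X → W → Matrix V V ℂ, (∀ x w, 0 ≤ E x w) ∧ ∑ x, ∑ w, reTrace (E x w) ≤ e ∧
    ∀ x w, R x w ≤ c • π x w + E x w

lemma ApproxLe.trans {X W : Type} [Fintype X] [Fintype W] {R π τ : X → W → Matrix V V ℂ}
    {c e c' e' : ℝ} (hc : 0 ≤ c) (h : ApproxLe R π c e) (h' : ApproxLe π τ c' e') :
    ApproxLe R τ (c * c') (c * e' + e) := by
  obtain ⟨E, hE0, hEt, hE⟩ := h
  obtain ⟨E', hE0', hEt', hE'⟩ := h'
  refine ⟨fun x w => c • E' x w + E x w,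
    fun x w => add_nonneg (smul_nonneg_matrix hc (hE0' x w)) (hE0 x w), ?_, fun x w => ?_⟩
  · simp only [map_add, map_smul, smul_eq_mul, Finset.sum_add_distrib, ← Finset.mul_sum]
    exact add_le_add (mul_le_mul_of_nonneg_left hEt' hc) hEt
  · refine (hE x w).trans ?_
    have h := smul_le_smul_matrix hc (hE' x w)
    refine (add_le_add_left h _).trans (le_of_eq ?_)
    module

lemma stepFamily_nonneg {A X W : Type} [Fintype A] [Fintype W] {M : A → X → ℝ}
    {Ψ : A → ℝ → W → W → Matrix V V ℂ →ₗ[ℝ] Matrix V V ℂ} (hΨ : ∀ a b, IsInstrument (Ψ a b))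
    (good : A → W → Prop) {π : X → W → Matrix V V ℂ} (hπ : ∀ x w, 0 ≤ π x w) (x : X) (w' : W) :
    0 ≤ stepFamily M Ψ good π x w' := by
  refine smul_nonneg_matrix (by positivity) (Finset.sum_nonneg fun a _ =>
    Finset.sum_nonneg fun w _ => ?_)
  split_ifs
  · exact (hΨ a _).nonneg _ _ _ (hπ x w)
  · exact le_rfl

lemma stepFamily_mono {A X W : Type} [Fintype A] [Fintype W] {M : A → X → ℝ}
    {Ψ : A → ℝ → W → W → Matrix V V ℂ →ₗ[ℝ] Matrix V V ℂ} (hΨ : ∀ a b, IsInstrument (Ψ a b))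
    (good : A → W → Prop) {π π' : X → W → Matrix V V ℂ} (h : ∀ x w, π x w ≤ π' x w)
    (x : X) (w' : W) : stepFamily M Ψ good π x w' ≤ stepFamily M Ψ good π' x w' := by
  refine smul_le_smul_matrix (by positivity) (Finset.sum_le_sum fun a _ =>
    Finset.sum_le_sum fun w _ => ?_)
  split_ifs
  · exact map_le_of_nonneg _ ((hΨ a _).nonneg w w') (h x w)
  · exact le_rfl

lemma stepFamily_add_smul {A X W : Type} [Fintype A] [Fintype W] (M : A → X → ℝ)
    (Ψ : A → ℝ → W → W → Matrix V V ℂ →ₗ[ℝ] Matrix V V ℂ)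
    (good : A → W → Prop) (c : ℝ) (π E : X → W → Matrix V V ℂ) (x : X) (w' : W) :
    stepFamily M Ψ good (fun x w => c • π x w + E x w) x w' =
      c • stepFamily M Ψ good π x w' + stepFamily M Ψ good E x w' := by
  simp only [stepFamily, smul_comm c, ← smul_add, Finset.smul_sum (r := c),
    ← Finset.sum_add_distrib]
  congr 1
  refine Finset.sum_congr rfl fun a _ => Finset.sum_congr rfl fun w _ => ?_
  split_ifs <;> simp

lemma sum_reTrace_stepFamily_le {A X W : Type} [Fintype A] [Fintype X] [Fintype W] (M : A → X → ℝ)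
    {Ψ : A → ℝ → W → W → Matrix V V ℂ →ₗ[ℝ] Matrix V V ℂ} (hΨ : ∀ a b, IsInstrument (Ψ a b))
    {good : A → W → Prop} {p : ℝ} (hp : 0 ≤ p)
    (hgood : ∀ w, ((Finset.univ.filter fun a => good a w).card : ℝ) ≤ p * Fintype.card A)
    {π : X → W → Matrix V V ℂ} (hπ : ∀ x w, 0 ≤ π x w) :
    ∑ x, ∑ w, reTrace (stepFamily M Ψ good π x w) ≤ p * ∑ x, ∑ w, reTrace (π x w) := by
  rw [Finset.mul_sum]
  refine Finset.sum_le_sum fun x _ => ?_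
  simp only [stepFamily, map_smul, map_sum, smul_eq_mul, ← Finset.mul_sum]
  have h1 : ∑ w', ∑ a, ∑ w, reTrace (if good a w then Ψ a (M a x) w w' (π x w) else 0)
      ≤ ∑ w, p * Fintype.card A * reTrace (π x w) := by
    rw [Finset.sum_comm]
    calc _ = ∑ a, ∑ w, ∑ w', reTrace (if good a w then Ψ a (M a x) w w' (π x w) else 0) :=
          Finset.sum_congr rfl fun a _ => Finset.sum_comm
      _ ≤ ∑ a, ∑ w, if good a w then reTrace (π x w) else 0 := by
          refine Finset.sum_le_sum fun a _ => Finset.sum_le_sum fun w _ => ?_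
          split_ifs
          · exact (hΨ a _).sum_le w _ (hπ x w)
          · simp
      _ = ∑ w, ((Finset.univ.filter fun a => good a w).card : ℝ) * reTrace (π x w) := by
          rw [Finset.sum_comm]
          refine Finset.sum_congr rfl fun w _ => ?_
          rw [← Finset.sum_filter, Finset.sum_const, nsmul_eq_mul]
      _ ≤ _ := Finset.sum_le_sum fun w _ =>
          mul_le_mul_of_nonneg_right (hgood w) (reTrace_nonneg (hπ x w))
  rw [← Finset.mul_sum] at h1
  have h0 : 0 ≤ ∑ w, reTrace (π x w) := Finset.sum_nonneg fun w _ => reTrace_nonneg (hπ x w)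
  rcases (Nat.cast_nonneg (α := ℝ) (Fintype.card A)).eq_or_lt with hA | hA
  · rw [← hA]; simp only [_root_.inv_zero, zero_mul]; positivity
  · rw [inv_mul_le_iff₀ hA]
    calc _ ≤ _ := h1
      _ = _ := by ring

lemma ApproxLe.stepFamily {A X W : Type} [Fintype A] [Fintype X] [Fintype W] (M : A → X → ℝ)
    {Ψ : A → ℝ → W → W → Matrix V V ℂ →ₗ[ℝ] Matrix V V ℂ} (hΨ : ∀ a b, IsInstrument (Ψ a b))
    {R π : X → W → Matrix V V ℂ} {c e : ℝ} (h : ApproxLe R π c e) :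
    ApproxLe (_root_.stepFamily M Ψ (fun _ _ => True) R)
      (_root_.stepFamily M Ψ (fun _ _ => True) π) c e := by
  obtain ⟨E, hE0, hEt, hE⟩ := h
  refine ⟨_root_.stepFamily M Ψ (fun _ _ => True) E, stepFamily_nonneg hΨ _ hE0, ?_, fun x w => ?_⟩
  · refine (sum_reTrace_stepFamily_le M hΨ zero_le_one (fun w => ?_) hE0).trans (by simpa using hEt)
    simp
  · refine (stepFamily_mono hΨ _ hE x w).trans (le_of_eq ?_)
    exact stepFamily_add_smul M Ψ _ c π E x w

lemma approxLe_stepFamily_good {A X W : Type} [Fintype A] [Fintype X] [Fintype W] (M : A → X → ℝ)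
    {Ψ : A → ℝ → W → W → Matrix V V ℂ →ₗ[ℝ] Matrix V V ℂ} (hΨ : ∀ a b, IsInstrument (Ψ a b))
    {good : A → W → Prop} {p : ℝ} (hp : 0 ≤ p)
    (hgood : ∀ w, ((Finset.univ.filter fun a => ¬ good a w).card : ℝ) ≤ p * Fintype.card A)
    {τ : X → W → Matrix V V ℂ} (hτ : ∀ x w, 0 ≤ τ x w) (hτ1 : ∑ x, ∑ w, reTrace (τ x w) ≤ 1) :
    ApproxLe (_root_.stepFamily M Ψ (fun _ _ => True) τ) (_root_.stepFamily M Ψ good τ) 1 p := by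
  refine ⟨_root_.stepFamily M Ψ (fun a w => ¬ good a w) τ, stepFamily_nonneg hΨ _ hτ,
    (sum_reTrace_stepFamily_le M hΨ (good := fun a w => ¬ good a w) hp (fun w => by convert hgood w) hτ).trans (mul_le_of_le_one_right hp hτ1),
    fun x w' => le_of_eq ?_⟩
  simp only [_root_.stepFamily, one_smul, ← smul_add, ← Finset.sum_add_distrib]
  congr 1
  refine Finset.sum_congr rfl fun a _ => Finset.sum_congr rfl fun w _ => ?_
  by_cases h : good a w <;> simp [h]

/-- Nonnegative weightings which are at least `s` everywhere and exceed `s` by a function of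
`ℓ₂`-norm at most one. -/
structure IsTestWeight {X : Type} [Fintype X] (s : ℝ) (f : X → ℝ) : Prop where
  le : ∀ x, s ≤ f x
  sum_sq_le : ∑ x, (f x - s) ^ 2 ≤ 1

lemma TotalRenyiBound.mono {W : Type} [Fintype W] {k : ℕ} {σ τ : W → Matrix V V ℂ} {Z Z' : ℝ}
    (h : TotalRenyiBound k σ τ Z) (hZ : Z ≤ Z') : TotalRenyiBound k σ τ Z' := by
  obtain ⟨B, hB, hBZ⟩ := h
  exact ⟨B, hB, hBZ.trans hZ⟩

lemma reTrace_one [DecidableEq V] : reTrace (1 : Matrix V V ℂ) = Fintype.card V := by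
  simp [reTrace_apply]

/-- A family all of whose Rényi potentials are small can be truncated, at small cost, to one in
which every value of `x` has small conditional weight. -/
lemma exists_truncation [Nonempty V] {X W : Type} [Fintype X] [Fintype W]
    {π : X → W → Matrix V V ℂ} (hπ : ∀ x w, 0 ≤ π x w) (hπ1 : ∑ x, ∑ w, reTrace (π x w) ≤ 1)
    {s L lam γ η δ Z : ℝ} {k : ℕ} (hs : 0 ≤ s) (hL : 0 < L) (hlam : 0 < lam) (hγ0 : 0 ≤ γ)
    (hγ1 : γ < 1) (hη : 0 < η) (hγ : Fintype.card V * L ^ 2 ≤ γ * lam)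
    (hδ : Z / L ^ (k + 1) ≤ δ) (hs1 : ∃ f : X → ℝ, IsTestWeight s f)
    (hZ : ∀ f : X → ℝ, IsTestWeight s f →
      TotalRenyiBound k (fun w => ∑ x, f x • π x w) (fun w => ∑ x, π x w) Z) :
    ∃ τ : X → W → Matrix V V ℂ, (∀ x w, 0 ≤ τ x w) ∧ ∑ x, ∑ w, reTrace (τ x w) ≤ 1 ∧
      (∀ x w, τ x w ≤ (lam / (1 - γ)) • ∑ y, τ y w) ∧
      (∀ f : X → ℝ, IsTestWeight s f → TotalRenyiBound k (fun w => ∑ x, f x • τ x w)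
        (fun w => ∑ x, τ x w) (Z / (1 - γ) ^ k)) ∧
      ApproxLe π τ ((1 + η) ^ Fintype.card V) ((1 + η) ^ Fintype.card V *
        (Fintype.card W * (Fintype.card V * (1 + 1 / η) * δ) + γ)) := by
  have hγ1' : 0 < 1 - γ := by linarith
  set d := Fintype.card V with hd
  have hpos : ∀ w, 0 ≤ ∑ x, π x w := fun w => Finset.sum_nonneg fun x _ => hπ x w
  have hδ0 : 0 ≤ δ := by
    obtain ⟨f, hf⟩ := hs1
    obtain ⟨B, hB, hBZ⟩ := hZ f hf
    have : 0 ≤ Z := (Finset.sum_nonneg fun w _ => (hB w).nonneg).trans hBZ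
    exact le_trans (by positivity) hδ
  have hdir : ∀ w, ∀ v : V → ℂ, star v ⬝ᵥ v = 1 → ∀ g : X → ℝ, (∀ x, 0 ≤ g x) →
      ∑ x, g x ^ 2 ≤ 1 → L * qform v (∑ x, π x w) < qform v (∑ x, g x • π x w) →
      qform v (∑ x, π x w) ≤ δ := by
    intro w v hv g hg0 hg1 hlt
    obtain ⟨B, hB, hBZ⟩ := hZ (fun x => g x + s)
      ⟨fun x => by have := hg0 x; linarith, by simpa using hg1⟩
    refine ((hB w).qform_le hv hL (hlt.le.trans (qform_mono v ?_))).trans (le_trans ?_ hδ)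
    · exact Finset.sum_le_sum fun x _ => smul_le_smul_right_matrix (by linarith) (hπ x w)
    · refine div_le_div_of_nonneg_right (le_trans ?_ hBZ) (by positivity)
      exact Finset.single_le_sum (fun w _ => (hB w).nonneg) (Finset.mem_univ w)
  choose P hP hPP hPL E hE0 hEt hE using fun w => exists_projection_aux (fun x => hπ x w) hη hδ0
    (hdir w) d 1 isHermitian_one (mul_one 1) (by rw [reTrace_one])
  choose S hS hS' using fun w => (hPL w).exists_light (fun x => sandwich_nonneg _ (hπ x w)) hL.le
    hlam hγ
  set τ : X → W → Matrix V V ℂ := fun x w => if x ∈ S w then 0 else sandwich (P w) (π x w) with hτ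
  have hsand : ∀ x w, 0 ≤ sandwich (P w) (π x w) := fun x w => sandwich_nonneg _ (hπ x w)
  have hτle : ∀ x w, τ x w ≤ sandwich (P w) (π x w) := fun x w => by
    simp only [hτ]; split_ifs
    · exact hsand x w
    · exact le_rfl
  have hτ0 : ∀ x w, 0 ≤ τ x w := fun x w => by
    simp only [hτ]; split_ifs
    · exact le_rfl
    · exact hsand x w
  have htrle : ∀ x w, reTrace (sandwich (P w) (π x w)) ≤ reTrace (π x w) := fun x w =>
    reTrace_sandwich_le _ (hP w) (hPP w) (hπ x w)
  have hlow : ∀ w, (1 - γ) • ∑ x, sandwich (P w) (π x w) ≤ ∑ x, τ x w := by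
    intro w
    have h1 : ∑ x, sandwich (P w) (π x w) = ∑ x, τ x w + ∑ x ∈ S w, sandwich (P w) (π x w) := by
      rw [← Fintype.sum_ite_mem (S w), ← Finset.sum_add_distrib]
      refine Finset.sum_congr rfl fun x _ => ?_
      simp only [hτ]
      split_ifs <;> simp
    rw [sub_smul, one_smul, sub_le_iff_le_add]
    refine le_trans (le_of_eq h1) ?_
    exact add_le_add_right (hS w) _
  refine ⟨τ, hτ0, ?_, ?_, ?_, ?_⟩
  · refine le_trans (Finset.sum_le_sum fun x _ => Finset.sum_le_sum fun w _ => ?_) hπ1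
    exact (reTrace_mono (hτle x w)).trans (htrle x w)
  · intro x w
    by_cases hx : x ∈ S w
    · have : τ x w = 0 := by simp [hτ, hx]
      rw [this]
      exact smul_nonneg_matrix (by positivity) (Finset.sum_nonneg fun y _ => hτ0 y w)
    · refine ((hτle x w).trans (hS' w x hx)).trans ?_
      have := smul_le_smul_matrix (show 0 ≤ lam / (1 - γ) by positivity) (hlow w)
      rwa [smul_smul, div_mul_cancel₀ _ hγ1'.ne'] at this
  · intro f hf
    obtain ⟨B, hB, hBZ⟩ := hZ f hf
    refine ⟨fun w => B w / (1 - γ) ^ k, fun w => ?_, ?_⟩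
    · have h1 := ((hB w).sandwich (hP w) (hPP w)).mono (σ' := ∑ x, f x • τ x w)
        (τ' := ∑ x, τ x w) one_pos hγ1' (by
          rw [one_smul, map_sum]
          refine Finset.sum_le_sum fun x _ => ?_
          rw [map_smul]
          exact smul_le_smul_matrix (hs.trans (hf.le x)) (hτle x w))
        (by rw [map_sum]; exact hlow w)
      rwa [one_pow, one_div_mul_eq_div] at h1
    · rw [← Finset.sum_div]
      exact div_le_div_of_nonneg_right hBZ (by positivity)
  · refine ⟨fun x w => E w x + (1 + η) ^ d • if x ∈ S w then sandwich (P w) (π x w) else 0,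
      fun x w => add_nonneg (hE0 w x) (smul_nonneg_matrix (by positivity) ?_), ?_, fun x w => ?_⟩
    · split_ifs
      · exact hsand x w
      · exact le_rfl
    · rw [Finset.sum_comm]
      simp only [map_add, map_smul, smul_eq_mul, Finset.sum_add_distrib, ← Finset.mul_sum]
      have h1 : ∑ w, ∑ x, reTrace (E w x) ≤
          (1 + η) ^ d * (Fintype.card W * (d * (1 + 1 / η) * δ)) := by
        refine (Finset.sum_le_sum fun w _ => hEt w).trans (le_of_eq ?_)
        rw [Finset.sum_const, nsmul_eq_mul, Finset.card_univ]
        ring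
      have h2 : ∑ w, ∑ x, reTrace (if x ∈ S w then sandwich (P w) (π x w) else 0) ≤ γ := by
        have h3 : ∀ w, ∑ x, reTrace (if x ∈ S w then sandwich (P w) (π x w) else 0) ≤
            γ * ∑ x, reTrace (π x w) := by
          intro w
          have := reTrace_mono (hS w)
          rw [← Fintype.sum_ite_mem (S w), map_smul, map_sum, map_sum, smul_eq_mul] at this
          exact this.trans (mul_le_mul_of_nonneg_left (Finset.sum_le_sum fun x _ => htrle x w) hγ0)
        refine (Finset.sum_le_sum fun w _ => h3 w).trans ?_
        rw [← Finset.mul_sum, Finset.sum_comm]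
        exact mul_le_of_le_one_right hγ0 hπ1
      have h4 := mul_le_mul_of_nonneg_left h2 (show 0 ≤ (1 + η) ^ d by positivity)
      linarith
    · have h1 := hE w x
      have h2 : sandwich 1 (π x w) = π x w := by simp [sandwich_apply]
      rw [h2] at h1
      refine h1.trans (le_of_eq ?_)
      simp only [hτ]
      split_ifs <;> simp [add_comm]

lemma ApproxLe.mono {X W : Type} [Fintype X] [Fintype W] {R π : X → W → Matrix V V ℂ}
    {c e c' e' : ℝ} (h : ApproxLe R π c e) (hπ : ∀ x w, 0 ≤ π x w) (hc : c ≤ c') (he : e ≤ e') :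
    ApproxLe R π c' e' := by
  obtain ⟨E, hE0, hEt, hE⟩ := h
  exact ⟨E, hE0, hEt.trans he, fun x w => (hE x w).trans
    (add_le_add_left (smul_le_smul_right_matrix hc (hπ x w)) _)⟩

lemma qform_single [DecidableEq V] (v : V) (Y : Matrix V V ℂ) :
    qform (Pi.single v 1) Y = (Y v v).re := by
  rw [qform_apply]; simp

lemma sum_qform_single [DecidableEq V] (Y : Matrix V V ℂ) :
    ∑ v, qform (Pi.single v 1) Y = reTrace Y := by
  simp only [qform_single, reTrace_apply, Matrix.trace, Complex.re_sum, diag_apply]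

/-- A guess for `x` succeeds with small probability when every `x` has small conditional weight. -/
lemma ApproxLe.guess_le {X W : Type} [Fintype X] [Fintype W] {R τ : X → W → Matrix V V ℂ}
    {c e κ : ℝ} (hc : 0 ≤ c) (hκ : 0 ≤ κ) (h : ApproxLe R τ c e)
    (hτ1 : ∑ x, ∑ w, reTrace (τ x w) ≤ 1) (hτκ : ∀ x w, τ x w ≤ κ • ∑ y, τ y w)
    (out : V × W → X) :
    ∑ v, ∑ w, (R (out (v, w)) w v v).re ≤ c * κ + e := by
  obtain ⟨E, hE0, hEt, hE⟩ := h
  have h1 : ∀ v w, (R (out (v, w)) w v v).re ≤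
      c * κ * qform (Pi.single v 1) (∑ x, τ x w) + qform (Pi.single v 1) (∑ x, E x w) := by
    intro v w
    rw [← qform_single]
    have h2 : R (out (v, w)) w ≤ (c * κ) • ∑ x, τ x w + ∑ x, E x w := by
      refine (hE _ w).trans (add_le_add ?_ ?_)
      · rw [← smul_smul]
        exact smul_le_smul_matrix hc (hτκ _ w)
      · exact Finset.single_le_sum (fun x _ => hE0 x w) (Finset.mem_univ _)
    simpa using qform_mono (Pi.single v 1) h2
  refine (Finset.sum_le_sum fun v _ => Finset.sum_le_sum fun w _ => h1 v w).trans ?_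
  rw [Finset.sum_comm]
  simp only [Finset.sum_add_distrib, ← Finset.mul_sum, sum_qform_single]
  have h3 : ∑ w, reTrace (∑ x, τ x w) ≤ 1 := by
    simp only [map_sum]; rwa [Finset.sum_comm]
  have h4 : ∑ w, reTrace (∑ x, E x w) ≤ e := by
    simp only [map_sum]; rwa [Finset.sum_comm]
  exact add_le_add (mul_le_of_le_one_right (by positivity) h3) h4

lemma IsTestWeight.sum_le {X : Type} [Fintype X] [Nonempty X] {f : X → ℝ}
    (hf : IsTestWeight (1 / Real.sqrt (Fintype.card X)) f) :
    ∑ x, f x ≤ 2 * Real.sqrt (Fintype.card X) := by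
  set N : ℝ := (Fintype.card X : ℝ) with hN
  have hN0 : 0 < N := by rw [hN]; exact_mod_cast Fintype.card_pos
  have h1 : (∑ x, (f x - 1 / Real.sqrt N)) ^ 2 ≤ N * 1 := by
    refine (sq_sum_le_card_mul_sum_sq (s := (Finset.univ : Finset X))).trans ?_
    rw [Finset.card_univ, ← hN]
    exact mul_le_mul_of_nonneg_left hf.sum_sq_le hN0.le
  have h2 := Real.le_sqrt_of_sq_le h1
  rw [mul_one, Finset.sum_sub_distrib, Finset.sum_const, Finset.card_univ, nsmul_eq_mul, ← hN,
    mul_one_div, Real.div_sqrt] at h2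
  linarith

/-- `R` is, up to a factor `c` and an error `e`, bounded by a family in which every value of `x` has
conditional weight at most `κ` and all Rényi potentials are at most `Z`. -/
def HasTruncation {X W : Type} [Fintype X] [Fintype W] (R : X → W → Matrix V V ℂ) (s κ : ℝ) (k : ℕ)
    (Z c e : ℝ) : Prop :=
  ∃ τ : X → W → Matrix V V ℂ, (∀ x w, 0 ≤ τ x w) ∧
    ∑ x, ∑ w, reTrace (τ x w) ≤ 1 ∧ (∀ x w, τ x w ≤ κ • ∑ y, τ y w) ∧
    (∀ f : X → ℝ, IsTestWeight s f → TotalRenyiBound k (fun w => ∑ x, f x • τ x w)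
      (fun w => ∑ x, τ x w) Z) ∧ ApproxLe R τ c e

lemma hasTruncation_uniform [Nonempty V] {X W : Type} [Fintype X] [Fintype W] [Nonempty X]
    {R : X → W → Matrix V V ℂ} {r₀ : ℝ}
    (hr₀ : Fintype.card X * Fintype.card V * Fintype.card W * r₀ = 1) (hr₀' : 0 ≤ r₀)
    (hR : ∀ x w, R x w = r₀ • 1) {L lam γ η δ : ℝ} {k : ℕ} (hL : 0 < L) (hlam : 0 < lam)
    (hγ0 : 0 ≤ γ) (hγ1 : γ < 1) (hη : 0 < η) (hγ : Fintype.card V * L ^ 2 ≤ γ * lam)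
    (hδ : (2 / Real.sqrt (Fintype.card X)) ^ (k + 1) / L ^ (k + 1) ≤ δ) :
    HasTruncation R (1 / Real.sqrt (Fintype.card X)) (lam / (1 - γ)) k
      ((2 / Real.sqrt (Fintype.card X)) ^ (k + 1) / (1 - γ) ^ k) ((1 + η) ^ Fintype.card V)
      ((1 + η) ^ Fintype.card V *
        (Fintype.card W * (Fintype.card V * (1 + 1 / η) * δ) + γ)) := by
  have hN0 : (0 : ℝ) < Fintype.card X := by exact_mod_cast Fintype.card_pos
  have hs0 : 0 ≤ 1 / Real.sqrt (Fintype.card X) := by positivity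
  have hcon : IsTestWeight (1 / Real.sqrt (Fintype.card X))
    (fun _ : X => 1 / Real.sqrt (Fintype.card X)) := ⟨fun _ => le_rfl, by simp⟩
  have hone : (0 : Matrix V V ℂ) ≤ 1 := nonneg_iff_posSemidef.2 PosSemidef.one
  have hπ : ∀ x w, 0 ≤ R x w := fun x w => by
    rw [hR]; exact smul_nonneg_matrix hr₀' hone
  have htr : ∀ x w, reTrace (R x w) = r₀ * Fintype.card V := fun x w => by
    rw [hR, map_smul, reTrace_one, smul_eq_mul]
  have hπ1 : ∑ x, ∑ w, reTrace (R x w) ≤ 1 := by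
    simp only [htr, Finset.sum_const, Finset.card_univ, nsmul_eq_mul]
    rw [← hr₀]; apply le_of_eq; ring
  refine exists_truncation hπ hπ1 hs0 hL hlam hγ0 hγ1 hη hγ hδ ⟨_, hcon⟩ fun f hf => ?_
  have hS : 0 ≤ ∑ x, f x / Fintype.card X := Finset.sum_nonneg fun x _ =>
    div_nonneg (hs0.trans (hf.le x)) hN0.le
  refine ⟨fun w => (∑ x, f x / Fintype.card X) ^ (k + 1) * reTrace (∑ x, R x w), fun w => ?_, ?_⟩
  · have h6 := RenyiBound.of_smul (k := k) hS
      (Finset.sum_nonneg fun x (_ : x ∈ Finset.univ) => hπ x w)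
    convert h6 using 1
    simp only [hR, smul_smul, ← Finset.sum_smul, Finset.sum_const, Finset.card_univ,
      nsmul_eq_mul, ← Finset.sum_div, ← Finset.sum_mul]
    congr 1
    field_simp
  · rw [← Finset.mul_sum]
    simp only [map_sum]
    rw [Finset.sum_comm]
    refine (mul_le_of_le_one_right (by positivity) hπ1).trans ?_
    refine pow_le_pow_left₀ hS ?_ _
    rw [← Finset.sum_div, div_le_div_iff₀ hN0 (by positivity)]
    have h7 := mul_le_mul_of_nonneg_right hf.sum_le (Real.sqrt_nonneg (Fintype.card X))
    rwa [mul_assoc, Real.mul_self_sqrt hN0.le] at h7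

lemma HasTruncation.step [Nonempty V] {X A W : Type} [Fintype X] [Fintype A] [Fintype W]
    {M : A → X → ℝ} (hM : ∀ a x, M a x = 1 ∨ M a x = -1)
    {Ψ : A → ℝ → W → W → Matrix V V ℂ →ₗ[ℝ] Matrix V V ℂ}
    (hΨ : ∀ a b, IsInstrument (Ψ a b)) {R : X → W → Matrix V V ℂ}
    {s L lam γ η δ ε p Z c e : ℝ} {k : ℕ} (hs : 0 ≤ s) (hL : 0 < L) (hlam : 0 < lam)
    (hγ0 : 0 ≤ γ) (hγ1 : γ < 1) (hη : 0 < η) (hε0 : 0 ≤ ε) (hε1 : ε < 1) (hp : 0 ≤ p)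
    (hγ : Fintype.card V * L ^ 2 ≤ γ * lam) (hc : 0 ≤ c)
    (hcount : ∀ ξ : X → Matrix V V ℂ, (∀ x, 0 ≤ ξ x) →
      (∀ x, ξ x ≤ (lam / (1 - γ)) • ∑ y, ξ y) → ∀ f : X → ℝ, (f = 1 ∨ IsTestWeight s f) →
      ((Finset.univ.filter fun a => ¬ (∑ x, M a x • f x • ξ x ≤ ε • ∑ x, f x • ξ x ∧
        -(ε • ∑ x, f x • ξ x) ≤ ∑ x, M a x • f x • ξ x)).card : ℝ) ≤ p * Fintype.card A)
    (hδ : Z * (((1 + ε) ^ (k + 1) + p * 2 ^ (k + 1)) / (1 - ε) ^ k) / L ^ (k + 1) ≤ δ)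
    (h : HasTruncation R s (lam / (1 - γ)) k Z c e) :
    HasTruncation (stepFamily M Ψ (fun _ _ => True) R) s (lam / (1 - γ)) k
      (Z * (((1 + ε) ^ (k + 1) + p * 2 ^ (k + 1)) / (1 - ε) ^ k) / (1 - γ) ^ k)
      (c * (1 + η) ^ Fintype.card V)
      (c * ((1 + η) ^ Fintype.card V *
        (Fintype.card W * (Fintype.card V * (1 + 1 / η) * δ) + γ)) + (c * p + e)) := by
  obtain ⟨τ, h1, h2, h3, h4, h5⟩ := h
  obtain ⟨good, hgood⟩ : ∃ good : A → W → Prop, good = fun a w =>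
      ∑ x, M a x • τ x w ≤ ε • ∑ x, τ x w ∧ -(ε • ∑ x, τ x w) ≤ ∑ x, M a x • τ x w := ⟨_, rfl⟩
  have hgoodcard : ∀ w, ((Finset.univ.filter fun a => ¬ good a w).card : ℝ) ≤
      p * Fintype.card A := fun w => by
    have := hcount (fun x => τ x w) (fun x => h1 x w) (fun x => h3 x w) 1 (Or.inl rfl)
    simp only [Pi.one_apply, one_smul] at this
    rw [hgood]
    convert this
  have hπ : ∀ x w, 0 ≤ stepFamily M Ψ good τ x w := stepFamily_nonneg hΨ good h1
  have hApp3 := (h5.stepFamily M hΨ).trans hc (approxLe_stepFamily_good M hΨ hp hgoodcard h1 h2)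
  have hpot : ∀ f : X → ℝ, IsTestWeight s f →
      TotalRenyiBound k (fun w => ∑ x, f x • stepFamily M Ψ good τ x w)
        (fun w => ∑ x, stepFamily M Ψ good τ x w)
        (Z * (((1 + ε) ^ (k + 1) + p * 2 ^ (k + 1)) / (1 - ε) ^ k)) := by
    intro f hf
    have := (h4 f hf).stepFamily (κ := p) (ε := ε) (good := good) hM hΨ h1
      (fun x => hs.trans (hf.le x)) hε0 hε1 hp (fun a w h => by rw [hgood] at h; exact h)
      (fun w => hcount (fun x => τ x w) (fun x => h1 x w) (fun x => h3 x w) f (Or.inr hf))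
    refine this.mono (le_of_eq ?_)
    ring
  have hfull : ∑ x, ∑ w, reTrace (stepFamily M Ψ good τ x w) ≤ 1 := by
    refine (sum_reTrace_stepFamily_le M hΨ zero_le_one (fun w => ?_) h1).trans
      (by rwa [one_mul])
    rw [one_mul]
    exact_mod_cast Finset.card_le_univ _
  by_cases hs1 : ∃ f : X → ℝ, IsTestWeight s f
  swap
  · exact absurd ⟨fun _ => s, fun _ => le_rfl, by simp⟩ hs1
  obtain ⟨τ', h1', h2', h3', h4', h5'⟩ := exists_truncation (L := L) (k := k)
    hπ hfull hs hL hlam hγ0 hγ1 hη hγ hδ hs1 hpot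
  have hApp4 := hApp3.trans (by positivity) h5'
  rw [mul_one] at hApp4
  exact ⟨τ', h1', h2', h3', h4', hApp4⟩

/-- The success probability of a program whose memory consists of a quantum system `V` and a
classical register `W`, in terms of all the parameters of the argument. -/
theorem guess_le_of_parameters [Nonempty V] {X A W : Type} [Fintype X] [Fintype A] [Fintype W]
    [Nonempty X] {M : A → X → ℝ} (hM : ∀ a x, M a x = 1 ∨ M a x = -1)
    {Ψ : ℕ → A → ℝ → W → W → Matrix V V ℂ →ₗ[ℝ] Matrix V V ℂ}
    (hΨ : ∀ t a b, IsInstrument (Ψ t a b)) {R : ℕ → X → W → Matrix V V ℂ} {r₀ : ℝ}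
    (hr₀ : Fintype.card X * Fintype.card V * Fintype.card W * r₀ = 1) (hr₀' : 0 ≤ r₀)
    (hR₀ : ∀ x w, R 0 x w = r₀ • 1)
    (hR : ∀ t x w, R (t + 1) x w = stepFamily M (Ψ t) (fun _ _ => True) (R t) x w)
    {L lam γ η δ ε p c₃ : ℝ} {k T : ℕ} (hL : 0 < L) (hlam : 0 < lam)
    (hγ0 : 0 ≤ γ) (hγ1 : γ < 1) (hη : 0 < η) (hε0 : 0 ≤ ε) (hε1 : ε < 1) (hp : 0 ≤ p)
    (hγ : Fintype.card V * L ^ 2 ≤ γ * lam)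
    (hc₃ : (1 + η) ^ (Fintype.card V * (T + 1)) ≤ c₃)
    (hcount : ∀ ξ : X → Matrix V V ℂ, (∀ x, 0 ≤ ξ x) →
      (∀ x, ξ x ≤ (lam / (1 - γ)) • ∑ y, ξ y) → ∀ f : X → ℝ,
      (f = 1 ∨ IsTestWeight (1 / Real.sqrt (Fintype.card X)) f) →
      ((Finset.univ.filter fun a => ¬ (∑ x, M a x • f x • ξ x ≤ ε • ∑ x, f x • ξ x ∧
        -(ε • ∑ x, f x • ξ x) ≤ ∑ x, M a x • f x • ξ x)).card : ℝ) ≤ p * Fintype.card A)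
    (hδ : ∀ t ≤ T, (2 / Real.sqrt (Fintype.card X)) ^ (k + 1) *
      (((1 + ε) ^ (k + 1) + p * 2 ^ (k + 1)) / (1 - ε) ^ k / (1 - γ) ^ k) ^ t / L ^ (k + 1) ≤ δ)
    (out : V × W → X) :
    ∑ v, ∑ w, (R T (out (v, w)) w v v).re ≤ c₃ * (lam / (1 - γ)) +
      (T + 1) * (c₃ * (Fintype.card W * (Fintype.card V * (1 + 1 / η) * δ) + γ + p)) := by
  set s : ℝ := 1 / Real.sqrt (Fintype.card X) with hs
  set Z₀ := (2 / Real.sqrt (Fintype.card X)) ^ (k + 1) with hZ₀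
  set H := ((1 + ε) ^ (k + 1) + p * 2 ^ (k + 1)) / (1 - ε) ^ k with hH
  set u := Fintype.card W * (Fintype.card V * (1 + 1 / η) * δ) + γ with hu
  have hs0 : 0 ≤ s := by positivity
  have hγ1' : 0 < 1 - γ := by linarith
  have hδ0' := hδ 0 (Nat.zero_le _)
  rw [pow_zero, mul_one] at hδ0'
  have hδ0 : 0 ≤ δ := le_trans (by positivity) hδ0'
  have hu0 : 0 ≤ u := by positivity
  have hc₃0 : 0 ≤ c₃ := le_trans (by positivity) hc₃
  have hcle : ∀ t ≤ T + 1, (1 + η) ^ (Fintype.card V * t) ≤ c₃ := fun t ht =>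
    (pow_le_pow_right₀ (by linarith) (Nat.mul_le_mul_left _ ht)).trans hc₃
  have key : ∀ t, t ≤ T → ∃ e ≤ c₃ * u + t * (c₃ * (u + p)),
      HasTruncation (R t) s (lam / (1 - γ)) k (Z₀ * (H / (1 - γ) ^ k) ^ t / (1 - γ) ^ k)
        ((1 + η) ^ (Fintype.card V * (t + 1))) e := by
    intro t
    induction t with
    | zero =>
      intro _
      refine ⟨(1 + η) ^ Fintype.card V * u, ?_, ?_⟩
      · have := hcle 1 (by omega)
        rw [mul_one] at this
        simpa using mul_le_mul_of_nonneg_right this hu0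
      · have := hasTruncation_uniform hr₀ hr₀' hR₀ hL hlam hγ0 hγ1 hη hγ hδ0'
        rw [pow_zero, mul_one, zero_add, mul_one]
        exact this
    | succ t ih =>
      intro ht
      obtain ⟨e, he, hT⟩ := ih (by omega)
      have hR' : R (t + 1) = stepFamily M (Ψ t) (fun _ _ => True) (R t) := by
        funext x w; exact hR t x w
      have hZ : Z₀ * (H / (1 - γ) ^ k) ^ t / (1 - γ) ^ k * H =
          Z₀ * (H / (1 - γ) ^ k) ^ (t + 1) := by
        rw [pow_succ]; ring
      have h := hT.step hM (hΨ t) hs0 hL hlam hγ0 hγ1 hη hε0 hε1 hp hγ (by positivity) hcount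
        (δ := δ) (by rw [hZ]; exact hδ (t + 1) ht)
      rw [hZ, ← hR', ← pow_add, ← mul_add_one] at h
      refine ⟨_, ?_, h⟩
      rw [← mul_assoc, ← pow_add, ← mul_add_one]
      have h6 := mul_le_mul_of_nonneg_right (hcle (t + 1 + 1) (by omega)) hu0
      have h7 := mul_le_mul_of_nonneg_right (hcle (t + 1) (by omega)) hp
      push_cast
      linarith
  obtain ⟨e, he, τ, h1, h2, h3, -, h5⟩ := key T le_rfl
  have hκ : 0 ≤ lam / (1 - γ) := by positivity
  refine (h5.guess_le (by positivity) hκ h2 h3 out).trans ?_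
  have h6 := mul_le_mul_of_nonneg_right hc₃ hκ
  have h7 : c₃ * u ≤ c₃ * (u + p) := mul_le_mul_of_nonneg_left (by linarith) hc₃0
  linarith

lemma IsTestWeight.sum_sq_le_four {X : Type} [Fintype X] [Nonempty X] {f : X → ℝ}
    (hf : IsTestWeight (1 / Real.sqrt (Fintype.card X)) f) : ∑ x, f x ^ 2 ≤ 4 := by
  have hN0 : (0 : ℝ) < Fintype.card X := by exact_mod_cast Fintype.card_pos
  set s : ℝ := 1 / Real.sqrt (Fintype.card X) with hs
  have h1 : Fintype.card X * s ^ 2 = 1 := by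
    rw [hs, div_pow, Real.sq_sqrt hN0.le]; field_simp
  calc ∑ x, f x ^ 2 ≤ ∑ x, (2 * (f x - s) ^ 2 + 2 * s ^ 2) :=
        Finset.sum_le_sum fun x _ => by nlinarith [sq_nonneg (f x - 2 * s)]
    _ = 2 * ∑ x, (f x - s) ^ 2 + 2 * (Fintype.card X * s ^ 2) := by
        rw [Finset.sum_add_distrib, ← Finset.mul_sum, Finset.sum_const, Finset.card_univ,
          nsmul_eq_mul]
        ring
    _ ≤ 4 := by rw [h1]; linarith [hf.sum_sq_le]

lemma IsL2Extractor.card_biased_le [Nonempty V] {X A : Type} [Fintype X] [Fintype A] [Nonempty X]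
    {M : A → X → ℝ} {k l e κ : ℝ} (hM : IsL2Extractor M k l e) (he : 0 < e) (hκ : 0 ≤ κ)
    (hκ1 : Real.sqrt κ ≤ 2 ^ l * 2 ^ (-(nbits X) / 2))
    (hκ2 : 2 * κ * Real.sqrt (Fintype.card X) ≤ 2 ^ l * 2 ^ (-(nbits X) / 2))
    {ξ : X → Matrix V V ℂ} (hξ : ∀ x, 0 ≤ ξ x) (hξκ : ∀ x, ξ x ≤ κ • ∑ y, ξ y) {f : X → ℝ}
    (hf : f = 1 ∨ IsTestWeight (1 / Real.sqrt (Fintype.card X)) f) :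
    ((Finset.univ.filter fun a => ¬ (∑ x, M a x • f x • ξ x ≤
        (2 * Fintype.card V ^ 2 * e) • ∑ x, f x • ξ x ∧
        -((2 * Fintype.card V ^ 2 * e) • ∑ x, f x • ξ x) ≤ ∑ x, M a x • f x • ξ x)).card : ℝ) ≤
      25 * 2 ^ (-k) * Fintype.card A := by
  have hN0 : (0 : ℝ) < Fintype.card X := by exact_mod_cast Fintype.card_pos
  have hs0 : 0 < 1 / Real.sqrt (Fintype.card X) := by positivity
  have hf0 : ∀ x, 0 ≤ f x := by
    rcases hf with rfl | hf
    · intro x; simp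
    · exact fun x => hs0.le.trans (hf.le x)
  suffices H : ∀ u, 0 < qform u (∑ x, f x • ξ x) →
      ((Finset.univ.filter fun a => e ≤ |∑ x, M a x *
        (qform u (f x • ξ x) / qform u (∑ y, f y • ξ y))|).card : ℝ) ≤
        2 ^ (-k) * Fintype.card A by
    have hb := _root_.card_biased_le M (ξ := fun x => f x • ξ x)
      (fun x => smul_nonneg_matrix (hf0 x) (hξ x)) he (by positivity) H
    rw [mul_assoc (25 : ℝ)]
    convert hb
  intro u hu
  have hq : ∀ x, 0 ≤ qform u (ξ x) := fun x => by simpa using qform_mono u (hξ x)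
  have hqκ : ∀ x, qform u (ξ x) ≤ κ * ∑ y, qform u (ξ y) := fun x => by
    simpa using qform_mono u (hξκ x)
  simp only [map_sum, map_smul, smul_eq_mul] at hu ⊢
  set S := ∑ y, f y * qform u (ξ y) with hS
  have h := hM (fun x => f x * qform u (ξ x) / S)
    (fun x => div_nonneg (mul_nonneg (hf0 x) (hq x)) hu.le)
    (by rw [← Finset.sum_div, ← hS, div_self hu.ne']) ?_
  · rw [← Set.ncard_coe_finset, Finset.coe_filter]
    simpa using h
  · rcases hf with rfl | hf
    · refine (Real.sqrt_le_sqrt ?_).trans hκ1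
      simp only [Pi.one_apply, one_mul] at hS ⊢
      calc ∑ x, (qform u (ξ x) / S) ^ 2 ≤ ∑ x, κ * (qform u (ξ x) / S) := by
            refine Finset.sum_le_sum fun x _ => ?_
            rw [sq]
            refine mul_le_mul_of_nonneg_right ?_ (div_nonneg (hq x) hu.le)
            rw [div_le_iff₀ hu, hS]
            exact hqκ x
        _ = κ := by rw [← Finset.mul_sum, ← Finset.sum_div, ← hS, div_self hu.ne', mul_one]
    · refine Real.sqrt_le_iff.2 ⟨by positivity, ?_⟩ |>.trans hκ2
      have h1 : ∑ y, qform u (ξ y) ≤ Real.sqrt (Fintype.card X) * S := by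
        rw [hS, Finset.mul_sum]
        refine Finset.sum_le_sum fun x _ => ?_
        have h2 := mul_le_mul_of_nonneg_right (hf.le x) (hq x)
        have h3 : Real.sqrt (Fintype.card X) * (1 / Real.sqrt (Fintype.card X)) = 1 := by
          field_simp
        have h4 := mul_le_mul_of_nonneg_left h2 (Real.sqrt_nonneg (Fintype.card X))
        rwa [← mul_assoc, h3, one_mul] at h4
      calc ∑ x, (f x * qform u (ξ x) / S) ^ 2
          ≤ ∑ x, (κ * Real.sqrt (Fintype.card X) * f x) ^ 2 := by
            refine Finset.sum_le_sum fun x _ => pow_le_pow_left₀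
              (div_nonneg (mul_nonneg (hf0 x) (hq x)) hu.le) ?_ 2
            rw [div_le_iff₀ hu]
            calc f x * qform u (ξ x) ≤ f x * (κ * (Real.sqrt (Fintype.card X) * S)) :=
                  mul_le_mul_of_nonneg_left
                    ((hqκ x).trans (mul_le_mul_of_nonneg_left h1 hκ)) (hf0 x)
              _ = _ := by ring
        _ = (κ * Real.sqrt (Fintype.card X)) ^ 2 * ∑ x, f x ^ 2 := by
            simp only [mul_pow, Finset.mul_sum]
        _ ≤ (κ * Real.sqrt (Fintype.card X)) ^ 2 * 4 :=
            mul_le_mul_of_nonneg_left hf.sum_sq_le_four (by positivity)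
        _ = _ := by ring

lemma QChannel.map_nonneg {n : Type} [Fintype n] [DecidableEq n] (Φ : QChannel n)
    {σ : Matrix n n ℂ} (hσ : σ.PosSemidef) : (Φ.map σ).PosSemidef := by
  have h := Φ.completely_positive 1 (σ.submatrix Prod.fst Prod.fst) (hσ.submatrix _)
  exact h.submatrix fun i => (i, (0 : Fin 1))

/-- The state `Y ⊗ |w⟩⟨w|`. -/
def blockEmbed {W : Type} (w : W) : Matrix V V ℂ →ₗ[ℂ] Matrix (V × W) (V × W) ℂ where
  toFun Y := Matrix.of fun p p' => if p.2 = w ∧ p'.2 = w then Y p.1 p'.1 else 0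
  map_add' Y Y' := by ext p p'; by_cases h : p.2 = w ∧ p'.2 = w <;> simp [h]
  map_smul' c Y := by ext p p'; by_cases h : p.2 = w ∧ p'.2 = w <;> simp [h]

/-- The block of a state on which the classical register has the value `w`. -/
def blockProj {W : Type} (w : W) : Matrix (V × W) (V × W) ℂ →ₗ[ℂ] Matrix V V ℂ where
  toFun σ := σ.submatrix (fun v => (v, w)) (fun v => (v, w))
  map_add' _ _ := rfl
  map_smul' _ _ := rfl

lemma blockProj_apply {W : Type} (w : W) (σ : Matrix (V × W) (V × W) ℂ) (v v' : V) :
    blockProj w σ v v' = σ (v, w) (v', w) := rfl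

lemma blockEmbed_posSemidef {W : Type} [Fintype W] (w : W) {Y : Matrix V V ℂ}
    (hY : Y.PosSemidef) : (blockEmbed w Y).PosSemidef := by
  have h := (hY.submatrix (Prod.fst : V × W → V)).conjTranspose_mul_mul_same
    (Matrix.diagonal fun p : V × W => if p.2 = w then (1 : ℂ) else 0)
  convert h using 1
  ext p p'
  simp only [diagonal_conjTranspose, diagonal_mul, mul_diagonal]
  by_cases h1 : p.2 = w <;> by_cases h2 : p'.2 = w <;> simp [blockEmbed, h1, h2]

lemma trace_blockEmbed {W : Type} [Fintype W] (w : W) (Y : Matrix V V ℂ) :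
    (blockEmbed w Y).trace = Y.trace := by
  simp [blockEmbed, Matrix.trace, Fintype.sum_prod_type]

lemma sum_trace_blockProj {W : Type} [Fintype W] (σ : Matrix (V × W) (V × W) ℂ) :
    ∑ w, (blockProj w σ).trace = σ.trace := by
  simp only [blockProj, Matrix.trace, Fintype.sum_prod_type]
  rw [Finset.sum_comm]
  rfl

lemma ClassicalOnW.eq_sum_blockEmbed {W : Type} [Fintype W] {σ : Matrix (V × W) (V × W) ℂ}
    (hσ : ClassicalOnW σ) : σ = ∑ w, blockEmbed w (blockProj w σ) := by
  ext p p'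
  rw [Matrix.sum_apply]
  by_cases h : p.2 = p'.2
  · rw [Finset.sum_eq_single p.2]
    · simp [blockEmbed, blockProj, h]
      rw [← h]
    · intro w _ hw
      simp [blockEmbed, hw.symm]
    · simp
  · rw [hσ p p' h, Finset.sum_eq_zero]
    intro w _
    have : ¬ (p.2 = w ∧ p'.2 = w) := fun hw => h (hw.1.trans hw.2.symm)
    simp [blockEmbed, this]

/-- The instrument obtained from a channel by preparing and then reading the classical register. -/
def QChannel.instrument {W : Type} [Fintype W] [DecidableEq (V × W)] (Φ : QChannel (V × W))
    (w w' : W) : Matrix V V ℂ →ₗ[ℝ] Matrix V V ℂ :=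
  (blockProj w' ∘ₗ Φ.map ∘ₗ blockEmbed w).restrictScalars ℝ

lemma QChannel.isInstrument {W : Type} [Fintype W] [DecidableEq (V × W)] (Φ : QChannel (V × W)) :
    IsInstrument Φ.instrument where
  nonneg w w' Y hY := by
    rw [nonneg_iff_posSemidef] at hY ⊢
    exact (Φ.map_nonneg (blockEmbed_posSemidef w hY)).submatrix _
  sum_le w Y hY := by
    simp only [reTrace_apply]
    rw [← Complex.re_sum]
    change (∑ w', (blockProj w' (Φ.map (blockEmbed w Y))).trace).re ≤ _
    rw [sum_trace_blockProj, Φ.trace_preserving, trace_blockEmbed]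

section Program

variable {X A : Type} [Fintype X] [DecidableEq X] [Fintype A] {q m : ℕ}
  (M : A → X → ℝ) (Φ : ℕ → A → ℝ → QChannel (Fin (2 ^ q) × (Fin m → Bool)))

/-- The unnormalised state of the memory given the value `x` of the secret. -/
def memoryState (t : ℕ) (x : X) :
    Matrix (Fin (2 ^ q) × (Fin m → Bool)) (Fin (2 ^ q) × (Fin m → Bool)) ℂ :=
  Matrix.of fun u u' => rhoSeq M Φ t (x, u) (x, u')

lemma memoryState_zero (x : X) :
    memoryState M Φ 0 x = ((Fintype.card X : ℂ) * 2 ^ q * 2 ^ m)⁻¹ • 1 := by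
  ext u u'
  simp [memoryState, rhoSeq, Matrix.one_apply]

lemma memoryState_succ (t : ℕ) (x : X) : memoryState M Φ (t + 1) x =
    (Fintype.card A : ℂ)⁻¹ • ∑ a, (Φ t a (M a x)).map (memoryState M Φ t x) := by
  ext u u'
  simp only [memoryState, rhoSeq, Matrix.of_apply, Matrix.smul_apply, Matrix.sum_apply]
  congr 1
  refine Finset.sum_congr rfl fun a _ => ?_
  rw [Finset.sum_eq_single x]
  · simp
  · intro y _ hy
    simp [hy.symm]
  · simp

lemma memoryState_posSemidef (t : ℕ) (x : X) : (memoryState M Φ t x).PosSemidef := by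
  induction t with
  | zero =>
    rw [memoryState_zero]
    exact PosSemidef.one.smul (by positivity)
  | succ t ih =>
    rw [memoryState_succ]
    exact (posSemidef_sum _ fun a _ => (Φ t a _).map_nonneg ih).smul (by positivity)

variable {Φ} in
lemma memoryState_classicalOnW (hΦ : ∀ t a b σ, σ.PosSemidef → ClassicalOnW σ →
    ClassicalOnW ((Φ t a b).map σ)) (t : ℕ) (x : X) : ClassicalOnW (memoryState M Φ t x) := by
  induction t with
  | zero =>
    intro p p' h
    have : p ≠ p' := fun h' => h (by rw [h'])
    simp [memoryState_zero, this]
  | succ t ih =>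
    intro p p' h
    rw [memoryState_succ, Matrix.smul_apply, Matrix.sum_apply, Finset.sum_eq_zero, smul_zero]
    exact fun a _ => hΦ t a _ _ (memoryState_posSemidef M Φ t x) ih p p' h

variable {Φ} in
lemma blockProj_memoryState_succ (hΦ : ∀ t a b σ, σ.PosSemidef → ClassicalOnW σ →
    ClassicalOnW ((Φ t a b).map σ)) (t : ℕ) (x : X) (w : Fin m → Bool) :
    blockProj w (memoryState M Φ (t + 1) x) = stepFamily M (fun a b => (Φ t a b).instrument)
      (fun _ _ => True) (fun x w => blockProj w (memoryState M Φ t x)) x w := by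
  rw [memoryState_succ]
  conv_lhs => rw [(memoryState_classicalOnW M hΦ t x).eq_sum_blockEmbed]
  simp only [map_smul, map_sum, stepFamily, if_true]
  ext v v'
  simp [QChannel.instrument]

lemma succProb_eq (out : Fin (2 ^ q) × (Fin m → Bool) → X) (T : ℕ) : succProb M Φ out T =
    ∑ v, ∑ w, (blockProj w (memoryState M Φ T (out (v, w))) v v).re := rfl

end Program

lemma growth_pow_le {ε p y : ℝ} {k t : ℕ} (hε0 : 0 ≤ ε) (hε : ε ≤ y ^ 2) (hp : 0 ≤ p)
    (hy0 : 0 < y) (hy : y ≤ 1 / 2) (hpy : p * 2 ^ (k + 1) ≤ 25 * y) (ht : t * y ≤ 1 / 4)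
    (hk : 4 ≤ k) :
    (((1 + ε) ^ (k + 1) + p * 2 ^ (k + 1)) / (1 - ε) ^ k / (1 - y ^ 2) ^ k) ^ t ≤
      16 ^ (k + 1) := by
  have hy2 : y ^ 2 ≤ 1 / 2 := by nlinarith
  have hinv : ∀ z : ℝ, 0 ≤ z → z ≤ y ^ 2 → (1 - z)⁻¹ ≤ Real.exp (2 * y ^ 2) := by
    intro z hz hzy
    have h1 : 0 < 1 - z := by linarith
    refine le_trans ?_ (Real.add_one_le_exp _)
    rw [inv_le_iff_one_le_mul₀ h1]
    nlinarith
  have hnum : (1 + ε) ^ (k + 1) + p * 2 ^ (k + 1) ≤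
      Real.exp ((k + 1 : ℕ) * y ^ 2 + 25 * y) := by
    have h1 : (1 : ℝ) ≤ (1 + ε) ^ (k + 1) := one_le_pow₀ (by linarith)
    have h2 : (1 + ε) ^ (k + 1) ≤ Real.exp ((k + 1 : ℕ) * y ^ 2) := by
      rw [Real.exp_nat_mul]
      refine pow_le_pow_left₀ (by linarith) ?_ _
      linarith [Real.add_one_le_exp (y ^ 2)]
    have h3 : 1 + p * 2 ^ (k + 1) ≤ Real.exp (25 * y) := by
      linarith [Real.add_one_le_exp (25 * y)]
    rw [Real.exp_add]
    refine le_trans ?_ (mul_le_mul h2 h3 (by positivity) (Real.exp_pos _).le)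
    nlinarith [show 0 ≤ p * 2 ^ (k + 1) by positivity]
  have hden : ∀ z : ℝ, 0 ≤ z → z ≤ y ^ 2 → ((1 - z) ^ k)⁻¹ ≤ Real.exp (k * (2 * y ^ 2)) := by
    intro z hz hzy
    rw [Real.exp_nat_mul, ← inv_pow]
    exact pow_le_pow_left₀ (inv_nonneg.2 (by linarith)) (hinv z hz hzy) _
  have hε1 : 0 < 1 - ε := by linarith
  have hy1 : 0 < 1 - y ^ 2 := by linarith
  have hbase : ((1 + ε) ^ (k + 1) + p * 2 ^ (k + 1)) / (1 - ε) ^ k / (1 - y ^ 2) ^ k ≤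
      Real.exp (5 * (k + 1) * y ^ 2 + 25 * y) := by
    rw [div_eq_mul_inv, div_eq_mul_inv]
    calc _ ≤ Real.exp ((k + 1 : ℕ) * y ^ 2 + 25 * y) * Real.exp (k * (2 * y ^ 2)) *
          Real.exp (k * (2 * y ^ 2)) := by
          gcongr
          · exact hden ε hε0 hε
          · exact hden _ (sq_nonneg y) le_rfl
      _ ≤ _ := by
          rw [← Real.exp_add, ← Real.exp_add]
          apply Real.exp_le_exp.2
          push_cast
          nlinarith [sq_nonneg y]
  calc _ ≤ Real.exp (5 * (k + 1) * y ^ 2 + 25 * y) ^ t :=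
        pow_le_pow_left₀ (by positivity) hbase t
    _ = Real.exp (5 * (k + 1) * (t * y * y) + 25 * (t * y)) := by
        rw [← Real.exp_nat_mul]; congr 1; ring
    _ ≤ Real.exp ((k + 1 : ℕ) * 2) := by
        apply Real.exp_le_exp.2
        have h1 : t * y * y ≤ 1 / 8 := by
          calc t * y * y ≤ 1 / 4 * (1 / 2) := by gcongr
            _ = _ := by norm_num
        have h2 : (4 : ℝ) ≤ k := by exact_mod_cast hk
        push_cast
        nlinarith
    _ ≤ _ := by
        rw [Real.exp_nat_mul]
        refine pow_le_pow_left₀ (Real.exp_pos _).le ?_ _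
        have h1 : Real.exp 2 = Real.exp 1 * Real.exp 1 := by rw [← Real.exp_add]; norm_num
        have h2 := Real.exp_one_lt_d9
        have h3 := Real.exp_pos 1
        rw [h1]; nlinarith

/-- The success probability of a program, in terms of all the parameters of the argument. -/
lemma succProb_le_of_parameters {X A : Type} [Fintype X] [DecidableEq X] [Nonempty X] [Fintype A]
    {q m T : ℕ} {M : A → X → ℝ} (hM : ∀ a x, M a x = 1 ∨ M a x = -1) {k' l' e : ℝ}
    (hE : IsL2Extractor M k' l' e) (he : 0 < e)
    {Φ : ℕ → A → ℝ → QChannel (Fin (2 ^ q) × (Fin m → Bool))}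
    (hΦ : ∀ t a b σ, σ.PosSemidef → ClassicalOnW σ → ClassicalOnW ((Φ t a b).map σ))
    {L lam γ η δ c₃ : ℝ} {k : ℕ} (hL : 0 < L) (hlam : 0 < lam)
    (hγ0 : 0 ≤ γ) (hγ1 : γ < 1) (hη : 0 < η) (hε1 : 2 * (2 ^ q) ^ 2 * e < 1)
    (hγ : 2 ^ q * L ^ 2 ≤ γ * lam) (hc₃ : (1 + η) ^ (2 ^ q * (T + 1)) ≤ c₃)
    (hκ1 : Real.sqrt (lam / (1 - γ)) ≤ 2 ^ l' * 2 ^ (-(nbits X) / 2))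
    (hκ2 : 2 * (lam / (1 - γ)) * Real.sqrt (Fintype.card X) ≤ 2 ^ l' * 2 ^ (-(nbits X) / 2))
    (hδ : ∀ t ≤ T, (2 / Real.sqrt (Fintype.card X)) ^ (k + 1) *
      (((1 + 2 * (2 ^ q) ^ 2 * e) ^ (k + 1) + 25 * 2 ^ (-k') * 2 ^ (k + 1)) /
        (1 - 2 * (2 ^ q) ^ 2 * e) ^ k / (1 - γ) ^ k) ^ t / L ^ (k + 1) ≤ δ)
    (out : Fin (2 ^ q) × (Fin m → Bool) → X) :
    succProb M Φ out T ≤ c₃ * (lam / (1 - γ)) +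
      (T + 1) * (c₃ * (2 ^ m * (2 ^ q * (1 + 1 / η) * δ) + γ + 25 * 2 ^ (-k'))) := by
  have hV : (Fintype.card (Fin (2 ^ q)) : ℝ) = 2 ^ q := by simp
  have hW : (Fintype.card (Fin m → Bool) : ℝ) = 2 ^ m := by simp
  have hγ1' : 0 < 1 - γ := by linarith
  have hN0 : (0 : ℝ) < Fintype.card X := by exact_mod_cast Fintype.card_pos
  rw [succProb_eq, ← hW, ← hV]
  refine guess_le_of_parameters (V := Fin (2 ^ q)) (W := Fin m → Bool) hM
    (Ψ := fun t a b => (Φ t a b).instrument) (fun t a b => (Φ t a b).isInstrument)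
    (R := fun t x w => blockProj w (memoryState M Φ t x))
    (r₀ := ((Fintype.card X : ℝ) * 2 ^ q * 2 ^ m)⁻¹) ?_ (by positivity) ?_
    (fun t x w => blockProj_memoryState_succ M hΦ t x w) hL hlam hγ0 hγ1 hη
    (ε := 2 * (2 ^ q) ^ 2 * e) (by positivity) hε1 (by positivity) (by rwa [hV])
    (by simpa using hc₃) ?_ hδ out
  · rw [hV, hW]; field_simp
  · intro x w
    simp only [memoryState_zero, map_smul]
    ext v v'
    rw [Matrix.smul_apply, Matrix.smul_apply, blockProj_apply]
    by_cases h : v = v' <;> simp [Matrix.one_apply, h]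
  · intro ξ hξ hξκ f hf
    have := hE.card_biased_le he (div_nonneg hlam.le hγ1'.le) hκ1 hκ2 hξ hξκ hf
    rw [hV] at this
    exact this

lemma one_add_rpow_pow_le {r : ℝ} {q T : ℕ} (hq : (q : ℝ) ≤ r - 7)
    (hT1 : (T : ℝ) + 1 ≤ 2 ^ (r - 1)) : (1 + (2 : ℝ) ^ (-(2 * r))) ^ (2 ^ q * (T + 1)) ≤ 3 := by
  have h2 : (1 : ℝ) ≤ 2 := one_le_two
  have h20 : (0 : ℝ) < 2 := two_pos
  have hpow : ∀ {a b : ℝ}, a ≤ b → (2 : ℝ) ^ a ≤ 2 ^ b :=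
    fun h => Real.rpow_le_rpow_of_exponent_le h2 h
  have hdq : ((2 : ℝ) ^ q) = 2 ^ (q : ℝ) := (Real.rpow_natCast _ _).symm
  have e1 : (2 : ℝ) ^ (-(2 * r)) * (2 ^ q * (T + 1)) ≤ 1 := by
    calc _ ≤ (2 : ℝ) ^ (-(2 * r)) * (2 ^ (r - 7) * 2 ^ (r - 1)) := by
          rw [hdq]
          gcongr
      _ = 2 ^ (-(2 * r) + ((r - 7) + (r - 1))) := by
          rw [Real.rpow_add h20, Real.rpow_add h20]
      _ ≤ 2 ^ (0 : ℝ) := hpow (by linarith)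
      _ = 1 := Real.rpow_zero _
  calc (1 + (2 : ℝ) ^ (-(2 * r))) ^ (2 ^ q * (T + 1))
      ≤ Real.exp (2 ^ (-(2 * r))) ^ (2 ^ q * (T + 1)) := by
        refine pow_le_pow_left₀ (by positivity) ?_ _
        linarith [Real.add_one_le_exp ((2 : ℝ) ^ (-(2 * r)))]
    _ = Real.exp (2 ^ (-(2 * r)) * (2 ^ q * (T + 1))) := by
        rw [← Real.exp_nat_mul]; congr 1; push_cast; ring
    _ ≤ Real.exp 1 := Real.exp_le_exp.2 e1
    _ ≤ 3 := by linarith [Real.exp_one_lt_d9]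

lemma truncation_term_le {k' l' r : ℝ} {q m T K : ℕ} (hl' : 1000 ≤ l') (hr : 0 ≤ r)
    (hrl : r ≤ l' / 26 + 1 / 6) (hm : (m : ℝ) ≤ (k' - 1) * l' / 44) (hk' : 1000 ≤ k')
    (hq : (q : ℝ) ≤ r - 7) (hT1 : (T : ℝ) + 1 ≤ 2 ^ (r - 1)) (hK3 : (k' - 1) / 2 ≤ K) :
    ((T : ℝ) + 1) * (2 ^ m * (2 ^ q * (1 + 1 / 2 ^ (-(2 * r))) *
      2 ^ ((5 - l' / 4) * K))) ≤ 2 ^ (-r) := by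
  have h2 : (1 : ℝ) ≤ 2 := one_le_two
  have h20 : (0 : ℝ) < 2 := two_pos
  have hpow : ∀ {a b : ℝ}, a ≤ b → (2 : ℝ) ^ a ≤ 2 ^ b :=
    fun h => Real.rpow_le_rpow_of_exponent_le h2 h
  have hdq : ((2 : ℝ) ^ q) = 2 ^ (q : ℝ) := (Real.rpow_natCast _ _).symm
  have hdm : ((2 : ℝ) ^ m) = 2 ^ (m : ℝ) := (Real.rpow_natCast _ _).symm
  have e1 : 1 + 1 / (2 : ℝ) ^ (-(2 * r)) ≤ 2 ^ (1 + 2 * r) := by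
    rw [Real.rpow_neg h20.le, one_div, inv_inv, Real.rpow_add h20, Real.rpow_one]
    linarith [Real.one_le_rpow h2 (mul_nonneg h20.le hr)]
  calc _ ≤ (2 : ℝ) ^ (r - 1) * (2 ^ (m : ℝ) * (2 ^ (q : ℝ) * 2 ^ (1 + 2 * r) *
        2 ^ ((5 - l' / 4) * K))) := by
        rw [hdq, hdm]; gcongr
    _ = 2 ^ ((r - 1) + (m + (q + (1 + 2 * r) + (5 - l' / 4) * K))) := by
        rw [Real.rpow_add h20 (r - 1), Real.rpow_add h20 (m : ℝ),
          Real.rpow_add h20 (q + (1 + 2 * r)), Real.rpow_add h20 (q : ℝ)]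
    _ ≤ _ := by
        refine hpow ?_
        have f1 : (k' - 1) * l' ≤ 2 * K * l' :=
          mul_le_mul_of_nonneg_right (by linarith) (by linarith)
        have f2 : 499 * l' ≤ K * l' :=
          mul_le_mul_of_nonneg_right (by linarith) (by linarith)
        have f3 : (K : ℝ) * 1000 ≤ K * l' :=
          mul_le_mul_of_nonneg_left hl' K.cast_nonneg
        nlinarith

lemma potential_div_le {G l n : ℝ} {k : ℕ} (hG : G ≤ 16 ^ (k + 1)) :
    (2 / (2 : ℝ) ^ (n / 2)) ^ (k + 1) * G / (2 ^ (l / 4 - n / 2)) ^ (k + 1) ≤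
      2 ^ ((5 - l / 4) * (k + 1 : ℕ)) := by
  have h20 : (0 : ℝ) < 2 := two_pos
  calc _ ≤ (2 / (2 : ℝ) ^ (n / 2)) ^ (k + 1) * 16 ^ (k + 1) /
        (2 ^ (l / 4 - n / 2)) ^ (k + 1) := by gcongr
    _ = ((2 : ℝ) ^ (5 - l / 4)) ^ (k + 1) := by
        rw [← mul_pow, ← div_pow]
        congr 1
        have e1 : (2 : ℝ) ^ (5 - l / 4) * 2 ^ (l / 4 - n / 2) * 2 ^ (n / 2) = 32 := by
          rw [← Real.rpow_add h20, ← Real.rpow_add h20,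
            show 5 - l / 4 + (l / 4 - n / 2) + n / 2 = ((5 : ℕ) : ℝ) by push_cast; ring,
            Real.rpow_natCast]
          norm_num
        rw [div_eq_iff (by positivity), div_mul_eq_mul_div, div_eq_iff (by positivity), e1]
        norm_num
    _ = _ := by rw [Real.rpow_mul h20.le, Real.rpow_natCast]

/-- The choice of the parameters of the argument. -/
lemma succProb_le {X A : Type} [Fintype X] [DecidableEq X] [Fintype A] {M : A → X → ℝ}
    (hM : ∀ a x, M a x = 1 ∨ M a x = -1) {k' l' r' r : ℝ} (hk' : 1000 ≤ k') (hl' : 1000 ≤ l')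
    (hln : l' ≤ nbits X) (hE : IsL2Extractor M k' l' ((2 : ℝ) ^ (-r'))) {q m T : ℕ}
    {Φ : ℕ → A → ℝ → QChannel (Fin (2 ^ q) × (Fin m → Bool))}
    (hΦ : ∀ t a b σ, σ.PosSemidef → ClassicalOnW σ → ClassicalOnW ((Φ t a b).map σ))
    (out : Fin (2 ^ q) × (Fin m → Bool) → X) (hm : (m : ℝ) ≤ (k' - 1) * l' / 44)
    (hr' : r ≤ r' / 4) (hrl : r ≤ l' / 26 + 1 / 6) (hrk : r ≤ (k' - 1) / 2)
    (hq : (q : ℝ) ≤ r - 7) (hT : (T : ℝ) ≤ 2 ^ (r - 2)) :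
    succProb M Φ out T ≤ 100 * 2 ^ (-r) := by
  have hq0 : (0 : ℝ) ≤ q := q.cast_nonneg
  have h2 : (1 : ℝ) ≤ 2 := one_le_two
  have h20 : (0 : ℝ) < 2 := two_pos
  have hpow : ∀ {a b : ℝ}, a ≤ b → (2 : ℝ) ^ a ≤ 2 ^ b :=
    fun h => Real.rpow_le_rpow_of_exponent_le h2 h
  have hcard : Fintype.card X ≠ 0 := by
    intro h
    simp only [nbits, h, Nat.cast_zero, Real.logb_zero] at hln
    linarith
  have : Nonempty X := Fintype.card_pos_iff.1 (Nat.pos_of_ne_zero hcard)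
  set n := nbits X with hn
  have hN : (Fintype.card X : ℝ) = 2 ^ n := by
    rw [hn, nbits, Real.rpow_logb h20 (by norm_num)]
    exact_mod_cast Nat.pos_of_ne_zero hcard
  have hsqrt : Real.sqrt (Fintype.card X) = 2 ^ (n / 2) := by
    rw [hN, Real.sqrt_eq_rpow, ← Real.rpow_mul h20.le]; congr 1; ring
  have hy2 : (2 : ℝ) ^ (-(2 * r)) = (2 ^ (-r)) ^ 2 := by
    rw [← Real.rpow_natCast, ← Real.rpow_mul h20.le]; congr 1; push_cast; ring
  have hy7 : (2 : ℝ) ^ (-r) ≤ 1 / 128 := by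
    refine (hpow (show -r ≤ -7 by linarith)).trans ?_
    rw [Real.rpow_neg h20.le]
    norm_num
  have hy0 : (0 : ℝ) < 2 ^ (-r) := by positivity
  have hγ1 : (2 : ℝ) ^ (-(2 * r)) ≤ 1 / 2 := by rw [hy2]; nlinarith
  have hdq : ((2 : ℝ) ^ q) = 2 ^ (q : ℝ) := (Real.rpow_natCast _ _).symm
  have hdm : ((2 : ℝ) ^ m) = 2 ^ (m : ℝ) := (Real.rpow_natCast _ _).symm
  have hε : 2 * ((2 : ℝ) ^ q) ^ 2 * 2 ^ (-r') ≤ (2 ^ (-r)) ^ 2 := by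
    have e1 : 2 * ((2 : ℝ) ^ q) ^ 2 * 2 ^ (-r') = 2 ^ (1 + (q + q) + -r' : ℝ) := by
      rw [Real.rpow_add h20, Real.rpow_add h20 1, Real.rpow_add h20, Real.rpow_one, hdq, sq]
    rw [e1, ← hy2]
    exact hpow (by linarith)
  set K := ⌊k' - r⌋₊ with hK
  have hK1 : (K : ℝ) ≤ k' - r := Nat.floor_le (by linarith)
  have hK2 : k' - r < K + 1 := Nat.lt_floor_add_one _
  have hK3 : (k' - 1) / 2 ≤ K := by linarith
  have hK4 : 5 ≤ K := by
    have : (5 : ℝ) ≤ K := by linarith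
    exact_mod_cast this
  obtain ⟨k, hk⟩ : ∃ k, K = k + 1 := ⟨K - 1, by omega⟩
  have hTy : (T : ℝ) * 2 ^ (-r) ≤ 1 / 4 := by
    refine (mul_le_mul_of_nonneg_right hT hy0.le).trans ?_
    rw [← Real.rpow_add h20]
    refine (hpow (show r - 2 + -r ≤ -2 by linarith)).trans ?_
    rw [Real.rpow_neg h20.le]
    norm_num
  have hT1 : (T : ℝ) + 1 ≤ 2 ^ (r - 1) := by
    have e1 : (2 : ℝ) ^ (r - 1) = 2 ^ (r - 2) * 2 := by
      rw [← Real.rpow_add_one h20.ne']; congr 1; ring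
    have e3 : (1 : ℝ) ≤ 2 ^ (r - 2) := Real.one_le_rpow h2 (by linarith)
    linarith
  set κ : ℝ := 2 ^ (q + l' / 2 - n + 2 * r) / (1 - 2 ^ (-(2 * r))) with hκdef
  have hκ : κ ≤ 2 ^ (1 + q + l' / 2 - n + 2 * r) := by
    have e1 : (2 : ℝ) ^ (1 + q + l' / 2 - n + 2 * r) = 2 ^ (q + l' / 2 - n + 2 * r) * 2 := by
      rw [← Real.rpow_add_one h20.ne']; congr 1; ring
    rw [hκdef, e1, div_le_iff₀ (by linarith)]
    have : (0 : ℝ) < 2 ^ (q + l' / 2 - n + 2 * r) := by positivity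
    nlinarith
  have hκ0 : 0 ≤ κ := div_nonneg (by positivity) (by linarith)
  have hB : (2 : ℝ) ^ l' * 2 ^ (-n / 2) = 2 ^ (l' + -n / 2) := (Real.rpow_add h20 _ _).symm
  have main := succProb_le_of_parameters hM hE (by positivity) hΦ (L := 2 ^ (l' / 4 - n / 2))
    (lam := 2 ^ (q + l' / 2 - n + 2 * r)) (γ := 2 ^ (-(2 * r))) (η := 2 ^ (-(2 * r)))
    (δ := 2 ^ ((5 - l' / 4) * K)) (c₃ := 3) (k := k) (T := T) (by positivity) (by positivity)
    (by positivity) (by linarith) (by positivity) (by nlinarith) ?_ ?_ ?_ ?_ ?_ out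
  · have b1 : κ ≤ 2 * 2 ^ (-r) := by
      have e1 : 2 * (2 : ℝ) ^ (-r) = 2 ^ (1 + -r) := by rw [Real.rpow_add h20, Real.rpow_one]
      rw [e1]
      exact hκ.trans (hpow (by linarith))
    have b2 : ((T : ℝ) + 1) * 2 ^ (-(2 * r)) ≤ 2 ^ (-r) := by
      refine (mul_le_mul_of_nonneg_right hT1 (by positivity)).trans ?_
      rw [← Real.rpow_add h20]
      exact hpow (by linarith)
    have b3 : ((T : ℝ) + 1) * 2 ^ (-k') ≤ 2 ^ (-r) := by
      refine (mul_le_mul_of_nonneg_right hT1 (by positivity)).trans ?_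
      rw [← Real.rpow_add h20]
      exact hpow (by linarith)
    have b4 := truncation_term_le hl' (by linarith) hrl hm hk' hq hT1 hK3
    refine main.trans ?_
    linarith
  · rw [hdq, ← Real.rpow_natCast, ← Real.rpow_mul h20.le, ← Real.rpow_add h20,
      ← Real.rpow_add h20]
    exact hpow (by push_cast; linarith)
  · exact one_add_rpow_pow_le hq hT1
  · rw [← hn, hB, Real.sqrt_le_left (by positivity), ← Real.rpow_natCast, ← Real.rpow_mul h20.le]
    exact hκ.trans (hpow (by push_cast; linarith))
  · rw [← hn, hB, hsqrt]
    calc _ ≤ 2 * 2 ^ (1 + q + l' / 2 - n + 2 * r) * 2 ^ (n / 2) := by gcongr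
      _ = (2 : ℝ) ^ (1 + (1 + q + l' / 2 - n + 2 * r) + n / 2) := by
        rw [Real.rpow_add h20 _ (n / 2), Real.rpow_add h20 1, Real.rpow_one]
      _ ≤ _ := hpow (by linarith)
  · intro t ht
    have htT : (t : ℝ) ≤ T := by exact_mod_cast ht
    have hpK : 25 * (2 : ℝ) ^ (-k') * 2 ^ (k + 1) ≤ 25 * 2 ^ (-r) := by
      rw [← hk, mul_assoc, ← Real.rpow_natCast, ← Real.rpow_add h20]
      exact mul_le_mul_of_nonneg_left (hpow (by linarith)) (by norm_num)
    have hG := growth_pow_le (t := t) (by positivity) hε (by positivity) hy0 (by linarith) hpK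
      ((mul_le_mul_of_nonneg_right htT hy0.le).trans hTy) (by omega)
    rw [hy2, hsqrt, hk]
    exact potential_div_le hG

end HybridMemory

/-- **Main Theorem.** There are absolute constants `C > 0` and `N₀` such that for
every `(k',ℓ')`-L2 extractor `M` with error `2^{−r'}` (with `k', ℓ', r' ≥ N₀`, `ℓ' ≤ n`), and
`r = min{r'/4, ℓ'/26 + 1/6, (k'−1)/2}`, every branching program with hybrid memory of `q` qubits
of quantum memory, `m` bits of classical memory and length `T` for the learning problem
corresponding to `M` with `m ≤ (k'−1)ℓ'/44`, `q ≤ r − 7` and `T ≤ 2^{r−2}` has success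
probability at most `C·2^{q−r}`. -/
theorem hybrid_memory_sample_lower_bound :
    ∃ (C : ℝ) (N₀ : ℕ), 0 < C ∧
      ∀ (X A : Type) [Fintype X] [DecidableEq X] [Fintype A],
        ∀ M : A → X → ℝ, (∀ a x, M a x = 1 ∨ M a x = -1) →
        ∀ k' l' r' : ℝ, (N₀ : ℝ) ≤ k' → (N₀ : ℝ) ≤ l' → (N₀ : ℝ) ≤ r' →
          l' ≤ nbits X →
          IsL2Extractor M k' l' ((2 : ℝ) ^ (-r')) →
          ∀ (q m T : ℕ)
            (Φ : ℕ → A → ℝ → QChannel (Fin (2 ^ q) × (Fin m → Bool))),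
            (∀ (t : ℕ) (a : A) (b : ℝ)
                (σ : Matrix (Fin (2 ^ q) × (Fin m → Bool)) (Fin (2 ^ q) × (Fin m → Bool)) ℂ),
              σ.PosSemidef → ClassicalOnW σ → ClassicalOnW ((Φ t a b).map σ)) →
            ∀ out : Fin (2 ^ q) × (Fin m → Bool) → X,
              (m : ℝ) ≤ (k' - 1) * l' / 44 →
              (q : ℝ) ≤ min (r' / 4) (min (l' / 26 + 1 / 6) ((k' - 1) / 2)) - 7 →
              (T : ℝ) ≤ (2 : ℝ) ^ (min (r' / 4) (min (l' / 26 + 1 / 6) ((k' - 1) / 2)) - 2) →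
              succProb M Φ out T ≤
                C * (2 : ℝ) ^ ((q : ℝ) - min (r' / 4) (min (l' / 26 + 1 / 6) ((k' - 1) / 2))) := by
  refine ⟨100, 1000, by norm_num, ?_⟩
  intro X A _ _ _ M hM k' l' r' hk' hl' hr' hln hE q m T Φ hΦ out hm hq hT
  push_cast at hk' hl' hr'
  refine (succProb_le hM hk' hl' hln hE hΦ out hm (min_le_left _ _)
    ((min_le_right _ _).trans (min_le_left _ _)) ((min_le_right _ _).trans (min_le_right _ _))
    hq hT).trans ?_
  refine mul_le_mul_of_nonneg_left (Real.rpow_le_rpow_of_exponent_le one_le_two ?_) (by norm_num)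
  linarith [q.cast_nonneg (α := ℝ)]
end
end

section
/- Let 𝒳, 𝒲 be finite sets and 𝒱 = ℂ^d. Let Φ be a quantum channel on 𝒱 ⊗ ℂ^𝒲 such that for every positive semidefinite matrix σ on 𝒱 ⊗ ℂ^𝒲 that is classical on W, Φ(σ) is classical on W. Let ρ be a positive semidefinite matrix on ℂ^𝒳 ⊗ 𝒱 ⊗ ℂ^𝒲 with Tr[ρ] ≤ 1 that is classical on X and W, and write Φ(ρ) for (id_X ⊗ Φ)(ρ). Then for every unit vector v ∈ 𝒱 and every w ∈ 𝒲 with Tr[Φ(ρ)_{X|v,w}] > 0, the distribution P^{Φ(ρ)}_{X|v,w} is a finite convex combination of distributions of the form P^ρ_{X|v',w'}, where v' ∈ 𝒱 are unit vectors and w' ∈ 𝒲 satisfy Tr[ρ_{X|v',w'}] > 0. -/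
open scoped ComplexOrder Classical
open Matrix

noncomputable section

/-- A matrix on `ℂ^𝒳 ⊗ 𝒱 ⊗ ℂ^𝒲` is classical on `X` and `W`. -/
def ClassicalOnXW {X V W : Type*} (ρ : Matrix (X × V × W) (X × V × W) ℂ) : Prop :=
  ∀ p q : X × V × W, p.1 ≠ q.1 ∨ p.2.2 ≠ q.2.2 → ρ p q = 0

/-- Applying `id_X ⊗ Φ` to a matrix on `ℂ^𝒳 ⊗ 𝒱 ⊗ ℂ^𝒲`. -/
def idTensorChan {X V W : Type*} [Fintype V] [DecidableEq V] [Fintype W] [DecidableEq W]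
    (Φ : QChannel (V × W)) (ρ : Matrix (X × V × W) (X × V × W) ℂ) :
    Matrix (X × V × W) (X × V × W) ℂ :=
  Matrix.of fun p q => Φ.map (Matrix.of fun s s' => ρ (p.1, s) (q.1, s')) p.2 q.2

/-- The conditional block `ρ_{X|v,w} = (I_X ⊗ ⟨v| ⊗ ⟨w|) ρ (I_X ⊗ |v⟩ ⊗ |w⟩)`. -/
def condXvw {X W : Type*} {d : ℕ} [Fintype X]
    (ρ : Matrix (X × Fin d × W) (X × Fin d × W) ℂ) (v : Fin d → ℂ) (w : W) :
    Matrix X X ℂ :=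
  Matrix.of fun x x' =>
    ∑ u : Fin d, ∑ u' : Fin d, star (v u) * ρ (x, u, w) (x', u', w) * v u'

/-- The induced distribution `diag(σ)/Tr[σ]` on `X` (junk value `0` when the trace vanishes). -/
def distOf {X : Type*} [Fintype X] (σ : Matrix X X ℂ) : X → ℝ :=
  fun x => (σ x x).re / σ.trace.re

/-- A unit vector of `ℂ^d`. -/
def IsUnitVec {d : ℕ} (v : Fin d → ℂ) : Prop :=
  (∑ u, Complex.normSq (v u)) = 1

/-- A linear functional on complex matrices that is nonnegative on positive semidefinite matrices
is a finite sum of quadratic forms. -/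
theorem exists_eq_sum_dotProduct_mulVec_of_nonneg {n : Type*} [Fintype n] [DecidableEq n]
    (f : Matrix n n ℂ →ₗ[ℂ] ℂ) (hf : ∀ A : Matrix n n ℂ, A.PosSemidef → 0 ≤ f A) :
    ∃ (m : ℕ) (c : Fin m → n → ℂ), ∀ A : Matrix n n ℂ,
      f A = ∑ i, star (c i) ⬝ᵥ (A *ᵥ c i) := by
  set M : Matrix n n ℂ := Matrix.of fun i j => f (Matrix.single j i 1) with hM
  have hfA : ∀ A : Matrix n n ℂ, f A = ∑ i, ∑ j, A i j * M j i := by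
    intro A
    conv_lhs => rw [matrix_eq_sum_single A]
    simp only [map_sum, hM, Matrix.of_apply]
    refine Finset.sum_congr rfl fun i _ => Finset.sum_congr rfl fun j _ => ?_
    rw [← smul_eq_mul, ← map_smul, Matrix.smul_single, smul_eq_mul, mul_one]
  have hquad : ∀ y : n → ℂ, 0 ≤ star y ⬝ᵥ (M *ᵥ y) := by
    intro y
    have h := hf _ (posSemidef_vecMulVec_self_star y)
    rw [hfA, Finset.sum_comm] at h
    convert h using 1
    simp only [dotProduct, mulVec, Finset.mul_sum, vecMulVec_apply]
    exact Finset.sum_congr rfl fun i _ => Finset.sum_congr rfl fun j _ => by ring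
  have hpsd : M.PosSemidef := by
    rw [← Matrix.isPositive_toEuclideanLin_iff, LinearMap.isPositive_iff_complex]
    intro x
    have h := hquad x.ofLp
    have h2 : inner ℂ (toEuclideanLin M x) x = star (star x.ofLp ⬝ᵥ (M *ᵥ x.ofLp)) := by
      rw [EuclideanSpace.inner_eq_star_dotProduct, star_dotProduct, star_star, dotProduct_comm]
      rfl
    rw [h2]
    obtain ⟨h3, h4⟩ := Complex.nonneg_iff.mp h
    constructor
    · apply Complex.ext <;> simp [← h4]
    · simpa using h3
  obtain ⟨m, c, hc⟩ := posSemidef_iff_eq_sum_vecMulVec.mp hpsd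
  refine ⟨m, c, fun A => ?_⟩
  rw [hfA, hc]
  simp only [Matrix.sum_apply, dotProduct, mulVec, Finset.mul_sum, vecMulVec_apply]
  rw [Finset.sum_comm_cycle]
  refine Finset.sum_congr rfl fun i _ => Finset.sum_congr rfl fun j _ =>
    Finset.sum_congr rfl fun k _ => ?_
  simp only [Pi.star_apply]
  ring

/-- The map `B ↦ B ⊗ |w⟩⟨w|`. -/
def embedAt {n W : Type*} [DecidableEq W] (w : W) :
    Matrix n n ℂ →ₗ[ℂ] Matrix (n × W) (n × W) ℂ where
  toFun B := kroneckerMap (· * ·) B (Matrix.single w w 1)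
  map_add' A B := add_kronecker A B _
  map_smul' r B := smul_kronecker r B _

theorem embedAt_posSemidef {n W : Type*} [Finite n] [Finite W] [DecidableEq W] (w : W)
    {B : Matrix n n ℂ} (hB : B.PosSemidef) : (embedAt w B).PosSemidef := by
  have := Fintype.ofFinite W
  have h := hB.kronecker (posSemidef_vecMulVec_self_star (Pi.single w (1 : ℂ)))
  rw [← Pi.single_star, star_one, ← single_eq_single_vecMulVec_single] at h
  exact h

theorem ClassicalOnW.eq_sum_embedAt {n W : Type*} [Fintype W] [DecidableEq W]
    {σ : Matrix (n × W) (n × W) ℂ} (h : ClassicalOnW σ) :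
    σ = ∑ w, embedAt w (σ.submatrix (fun u => (u, w)) fun u => (u, w)) := by
  ext ⟨i, a⟩ ⟨j, b⟩
  simp only [embedAt, Matrix.sum_apply, LinearMap.coe_mk, AddHom.coe_mk,
    kroneckerMap_apply, single_apply, submatrix_apply]
  by_cases hab : a = b
  · subst hab
    simp
  · rw [h _ _ hab]
    refine (Finset.sum_eq_zero fun x _ => ?_).symm
    simpa using fun hxa hxb => absurd (hxa.symm.trans hxb) hab

theorem QChannel.map_posSemidef {n : Type*} [Fintype n] [DecidableEq n] (Φ : QChannel n)
    {A : Matrix n n ℂ} (hA : A.PosSemidef) : (Φ.map A).PosSemidef :=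
  (Φ.completely_positive 1 (A.submatrix Prod.fst Prod.fst) (hA.submatrix _)).submatrix
    fun i => (i, 0)

/-- Every nonzero vector has a positive multiple that is a unit vector. -/
theorem exists_isUnitVec_smul {d : ℕ} {c : Fin d → ℂ} (hc : c ≠ 0) :
    ∃ r : ℝ, 0 < r ∧ IsUnitVec ((r : ℂ) • c) := by
  have hs : 0 < ∑ u, Complex.normSq (c u) := by
    obtain ⟨u, hu⟩ := Function.ne_iff.mp hc
    exact Finset.sum_pos' (fun _ _ => Complex.normSq_nonneg _)
      ⟨u, Finset.mem_univ _, Complex.normSq_pos.mpr hu⟩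
  refine ⟨(√(∑ u, Complex.normSq (c u)))⁻¹, by positivity, ?_⟩
  simp only [IsUnitVec, Pi.smul_apply, smul_eq_mul, Complex.normSq_mul, Complex.normSq_ofReal]
  rw [← Finset.mul_sum, ← mul_inv, Real.mul_self_sqrt hs.le, inv_mul_cancel₀ hs.ne']

section condXvw

variable {X W : Type*} {d : ℕ} [Fintype X]

theorem condXvw_apply_self (ρ : Matrix (X × Fin d × W) (X × Fin d × W) ℂ) (v : Fin d → ℂ) (w : W)
    (x : X) : condXvw ρ v w x x =
      star v ⬝ᵥ (ρ.submatrix (fun u => (x, u, w)) (fun u => (x, u, w)) *ᵥ v) := by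
  simp [condXvw, dotProduct, mulVec, Finset.mul_sum, mul_assoc]

theorem condXvw_apply_self_nonneg [Finite W] {ρ : Matrix (X × Fin d × W) (X × Fin d × W) ℂ}
    (hρ : ρ.PosSemidef) (v : Fin d → ℂ) (w : W) (x : X) : 0 ≤ (condXvw ρ v w x x).re := by
  rw [condXvw_apply_self]
  exact (Complex.nonneg_iff.mp ((hρ.submatrix _).dotProduct_mulVec_nonneg v)).1

theorem condXvw_smul (ρ : Matrix (X × Fin d × W) (X × Fin d × W) ℂ) (r : ℝ) (v : Fin d → ℂ)
    (w : W) : condXvw ρ ((r : ℂ) • v) w = ((r ^ 2 : ℝ) : ℂ) • condXvw ρ v w := by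
  ext x x'
  simp only [condXvw, Matrix.of_apply, Matrix.smul_apply, Pi.smul_apply, smul_eq_mul,
    Finset.mul_sum, star_mul', Complex.star_def, Complex.conj_ofReal]
  refine Finset.sum_congr rfl fun i _ => Finset.sum_congr rfl fun j _ => ?_
  push_cast
  ring

theorem trace_re_eq_sum (σ : Matrix X X ℂ) : σ.trace.re = ∑ x, (σ x x).re := by
  simp [Matrix.trace]

theorem distOf_smul (σ : Matrix X X ℂ) {r : ℝ} (hr : r ≠ 0) :
    distOf ((r : ℂ) • σ) = distOf σ := by
  ext x
  simp [distOf, Matrix.trace_smul, mul_div_mul_left _ _ hr]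

end condXvw

/-- For `ρ` classical on `X` and `W`, the diagonal of `Φ(ρ)_{X|v,w}` is a finite sum of diagonals of
`ρ_{X|c,w'}` for unnormalized vectors `c`. -/
theorem exists_condXvw_idTensorChan_eq_sum {X W : Type*} [Fintype X] [Fintype W] [DecidableEq W]
    {d : ℕ} (Φ : QChannel (Fin d × W)) (v : Fin d → ℂ) (w : W) :
    ∃ (m : W → ℕ) (c : ∀ w', Fin (m w') → Fin d → ℂ),
      ∀ ρ : Matrix (X × Fin d × W) (X × Fin d × W) ℂ, ClassicalOnXW ρ → ∀ x,
        condXvw (idTensorChan Φ ρ) v w x x =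
          ∑ i : Σ w', Fin (m w'), condXvw ρ (c i.1 i.2) i.1 x x := by
  let g : Matrix (Fin d × W) (Fin d × W) ℂ →ₗ[ℂ] ℂ :=
    { toFun := fun A => star v ⬝ᵥ
        ((Φ.map A).submatrix (fun u => (u, w)) (fun u => (u, w)) *ᵥ v)
      map_add' := fun A B => by
        rw [map_add, submatrix_add, Pi.add_apply, Pi.add_apply, add_mulVec, dotProduct_add]
      map_smul' := fun r A => by
        rw [map_smul, submatrix_smul, Pi.smul_apply, Pi.smul_apply, smul_mulVec,
          dotProduct_smul, RingHom.id_apply] }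
  have hg : ∀ A, A.PosSemidef → 0 ≤ g A := fun A hA =>
    ((Φ.map_posSemidef hA).submatrix _).dotProduct_mulVec_nonneg v
  choose m c hc using fun w' => exists_eq_sum_dotProduct_mulVec_of_nonneg (g ∘ₗ embedAt w')
    fun A hA => hg _ (embedAt_posSemidef w' hA)
  refine ⟨m, c, fun ρ hρ x => ?_⟩
  have hcl : ClassicalOnW (ρ.submatrix (fun s => (x, s)) (fun s => (x, s))) :=
    fun p q hpq => hρ _ _ (Or.inr hpq)
  calc condXvw (idTensorChan Φ ρ) v w x x
      = g (ρ.submatrix (fun s => (x, s)) (fun s => (x, s))) := condXvw_apply_self _ _ _ _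
    _ = _ := by
      rw [hcl.eq_sum_embedAt, map_sum, Fintype.sum_sigma]
      refine Finset.sum_congr rfl fun w' _ => ?_
      simp only [condXvw_apply_self]
      exact hc w' _

/-- After applying a channel that keeps `W` classical, each conditional
distribution `P^{Φ(ρ)}_{X|v,w}` is a convex combination of conditional distributions
`P^ρ_{X|v',w'}` of the original system. -/
theorem channel_cond_dist_convex_combination {X W : Type*} [Fintype X] [DecidableEq X]
    [Fintype W] [DecidableEq W] {d : ℕ}
    (Φ : QChannel (Fin d × W))
    (hΦ : ∀ σ : Matrix (Fin d × W) (Fin d × W) ℂ,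
      σ.PosSemidef → ClassicalOnW σ → ClassicalOnW (Φ.map σ))
    (ρ : Matrix (X × Fin d × W) (X × Fin d × W) ℂ)
    (hρ : ρ.PosSemidef) (htr : ρ.trace.re ≤ 1) (hcl : ClassicalOnXW ρ)
    (v : Fin d → ℂ) (hv : IsUnitVec v) (w : W)
    (hpos : 0 < (condXvw (idTensorChan Φ ρ) v w).trace.re) :
    ∃ (k : ℕ) (μ : Fin k → ℝ) (v' : Fin k → Fin d → ℂ) (w' : Fin k → W),
      (∀ i, 0 ≤ μ i) ∧ (∑ i, μ i) = 1 ∧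
      (∀ i, IsUnitVec (v' i) ∧ 0 < (condXvw ρ (v' i) (w' i)).trace.re) ∧
      (∀ x, distOf (condXvw (idTensorChan Φ ρ) v w) x =
        ∑ i, μ i * distOf (condXvw ρ (v' i) (w' i)) x) := by
  classical
  obtain ⟨m, c, hc⟩ := exists_condXvw_idTensorChan_eq_sum (X := X) Φ v w
  set T : (Σ w', Fin (m w')) → ℝ := fun i => (condXvw ρ (c i.1 i.2) i.1).trace.re with hT
  set S : ℝ := (condXvw (idTensorChan Φ ρ) v w).trace.re with hS
  have hT0 : ∀ i, 0 ≤ T i := fun i => by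
    simp only [hT, trace_re_eq_sum]
    exact Finset.sum_nonneg fun x _ => condXvw_apply_self_nonneg hρ _ _ x
  have hre : ∀ x, (condXvw (idTensorChan Φ ρ) v w x x).re =
      ∑ i : Σ w', Fin (m w'), (condXvw ρ (c i.1 i.2) i.1 x x).re := fun x => by
    rw [hc ρ hcl x, Complex.re_sum]
  have hsum : S = ∑ i, T i := by
    simp only [hS, hT, trace_re_eq_sum, hre]
    exact Finset.sum_comm
  have hunit : ∀ i : {i // 0 < T i}, ∃ r : ℝ, 0 < r ∧
      IsUnitVec ((r : ℂ) • c i.1.1 i.1.2) := fun i => by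
    refine exists_isUnitVec_smul fun h0 => i.2.ne' ?_
    simp [T, h0, condXvw, trace_re_eq_sum]
  choose r hr hru using hunit
  have hsub : ∀ f : (Σ w', Fin (m w')) → ℝ, (∀ i, T i = 0 → f i = 0) →
      ∑ i : {i // 0 < T i}, f i = ∑ i, f i := fun f hf => by
    rw [← Finset.sum_filter_of_ne (p := fun i => 0 < T i)
      fun i _ hi => (hT0 i).lt_of_ne' fun h => hi (hf i h)]
    exact (Finset.sum_subtype _ (by simp) f).symm
  have hzero : ∀ i, T i = 0 → ∀ x, (condXvw ρ (c i.1 i.2) i.1 x x).re = 0 := fun i hi x => by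
    simp only [hT, trace_re_eq_sum] at hi
    exact (Finset.sum_eq_zero_iff_of_nonneg fun x _ =>
      condXvw_apply_self_nonneg hρ _ _ x).mp hi x (Finset.mem_univ x)
  let e := (Fintype.equivFin {i // 0 < T i}).symm
  refine ⟨Fintype.card {i // 0 < T i}, fun k => T (e k) / S,
    fun k => (r (e k) : ℂ) • c (e k).1.1 (e k).1.2, fun k => (e k).1.1,
    fun k => div_nonneg (hT0 _) hpos.le, ?_, fun k => ⟨hru _, ?_⟩, fun x => ?_⟩
  · rw [e.sum_comp (fun i => T i / S), ← Finset.sum_div, div_eq_one_iff_eq hpos.ne', hsum]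
    exact hsub T fun _ h => h
  · rw [condXvw_smul, Matrix.trace_smul, smul_eq_mul, Complex.re_ofReal_mul]
    exact mul_pos (pow_pos (hr _) 2) (e k).2
  · simp only [condXvw_smul, distOf_smul _ (pow_pos (hr _) 2).ne']
    rw [e.sum_comp (fun i => T i / S * distOf (condXvw ρ (c i.1.1 i.1.2) i.1.1) x), distOf, hre,
      ← hS, Finset.sum_div, ← hsub _ fun i hi => by rw [hzero i hi, zero_div]]
    refine Finset.sum_congr rfl fun i _ => ?_
    have hi : T i ≠ 0 := i.2.ne'
    change _ = T i / S * (_ / T i)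
    field_simp
end
end
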